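/- Let U be a subunital of order q of the generalized hermitian unital H(C|R), where q ≥ 2 is an integer. Then q is a prime power and the incidence structure (U, { B ∩ U : B a block of H(C|R) with |B ∩ U| ≥ 2 }) is isomorphic to the hermitian unital H(GF(q²)|GF(q)): there is a bijection from U onto the point set of H(GF(q²)|GF(q)) that maps the blocks of the subunital onto the blocks of H(GF(q²)|GF(q)). -/

import Mathlib

noncomputable section

/-- A line of the projective plane `PG(2,C)`: the zero set of a nonzero linear form. -/
def IsLine (C : Type*) [Field C] (ℓ : Set (Projectivization C (Fin 3 → C))) : Prop :=
  ∃ f : (Fin 3 → C) →ₗ[C] C, f ≠ 0 ∧ ℓ = {P : Projectivization C (Fin 3 → C) | f P.rep = 0}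

/-- The point set of the generalized hermitian unital `H(C|R)`:
points `[X,Y,Z]` with `σ(X)·Y + σ(Z)·Z ∈ εR`. -/
def hermSet {C : Type*} [Field C] (R : Subfield C) (σ : C →+* C) (ε : C) :
    Set (Projectivization C (Fin 3 → C)) :=
  {P | ∃ v : Fin 3 → C, ∃ hv : v ≠ 0, P = Projectivization.mk C v hv ∧
        ∃ r ∈ R, σ (v 0) * v 1 + σ (v 2) * v 2 = ε * r}

/-- A block of `H(C|R)`: the trace of a line meeting the point set in at least two points. -/
def IsHermBlock {C : Type*} [Field C] (R : Subfield C) (σ : C →+* C) (ε : C)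
    (B : Set (Projectivization C (Fin 3 → C))) : Prop :=
  ∃ ℓ, IsLine C ℓ ∧ (hermSet R σ ε ∩ ℓ).Nontrivial ∧ B = hermSet R σ ε ∩ ℓ

/-- A subunital of order `q` of `H(C|R)`: a set `U` of `q³ + 1` points of the unital
such that every block containing at least two points of `U` contains exactly
`q + 1` points of `U`. -/
def IsSubunital {C : Type*} [Field C] (R : Subfield C) (σ : C →+* C) (ε : C)
    (q : ℕ) (U : Set (Projectivization C (Fin 3 → C))) : Prop :=
  U ⊆ hermSet R σ ε ∧ U.ncard = q ^ 3 + 1 ∧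
    ∀ B, IsHermBlock R σ ε B → (B ∩ U).Nontrivial → (B ∩ U).ncard = q + 1

/-- If every fibre of `f` on a finite set `s` has `n` elements, then `s` has `n` times as many
elements as its image. -/
theorem Set.ncard_eq_ncard_image_mul {α β : Type*} {f : α → β} {s : Set α} (hs : s.Finite) {n : ℕ}
    (h : ∀ a ∈ s, {x ∈ s | f x = f a}.ncard = n) : s.ncard = (f '' s).ncard * n := by
  classical
  lift s to Finset α using hs
  rw [Set.ncard_coe_finset, ← Finset.coe_image, Set.ncard_coe_finset,
    Finset.card_eq_sum_card_image f s, Finset.sum_const_nat]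
  intro b hb
  obtain ⟨a, ha, rfl⟩ := Finset.mem_image.1 hb
  rw [← h a ha, ← Set.ncard_coe_finset]
  congr 1
  ext x
  simp

/-- A finite additive subgroup of a field that contains `1` and whose nonzero inverses together
with `0` are closed under addition is closed under multiplication. -/
theorem mul_mem_of_harmonic {K : Type*} [Field K] (A : AddSubgroup K) (hfin : (A : Set K).Finite)
    (h1 : (1 : K) ∈ A)
    (hA : ∀ a ∈ A, ∀ b ∈ A, a ≠ 0 → b ≠ 0 → a + b ≠ 0 → a * b / (a + b) ∈ A) :
    (∀ a ∈ A, a⁻¹ ∈ A) ∧ ∀ a ∈ A, ∀ b ∈ A, a * b ∈ A := by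
  have sq_div : ∀ a ∈ A, ∀ c ∈ A, a ^ 2 / c ∈ A := by
    intro a ha c hc
    by_cases hc0 : c = 0
    · simp [hc0]
    by_cases ha0 : a = 0
    · simp [ha0]
    by_cases hac : c = a
    · rwa [hac, sq, mul_div_assoc, div_self ha0, mul_one]
    have h := hA a ha (c - a) (A.sub_mem hc ha) ha0 (sub_ne_zero.2 hac) (by simpa using hc0)
    convert A.sub_mem ha h using 1
    rw [add_sub_cancel]
    field_simp
    ring
  have inv : ∀ a ∈ A, a⁻¹ ∈ A := fun a ha ↦ by simpa using sq_div 1 h1 a ha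
  have sq_mul : ∀ a ∈ A, ∀ b ∈ A, a ^ 2 * b ∈ A := fun a ha b hb ↦ by
    simpa using sq_div a ha _ (inv b hb)
  have two_mul : ∀ a ∈ A, ∀ b ∈ A, 2 * a * b ∈ A := fun a ha b hb ↦ by
    convert A.sub_mem (A.sub_mem (sq_mul _ (A.add_mem ha h1) b hb) (sq_mul a ha b hb)) hb using 1
    ring
  refine ⟨inv, fun a ha b hb ↦ ?_⟩
  have surj : ∀ f : K → K, Set.MapsTo f A A → Set.InjOn f A → ∀ x ∈ A, ∃ y ∈ A, f y = x :=
    fun f hf hi x hx ↦ by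
      have := ((hfin.injOn_iff_bijOn_of_mapsTo hf).1 hi).surjOn hx
      simpa using this
  by_cases h2 : (2 : K) = 0
  · obtain ⟨c, hc, rfl⟩ := surj (fun x ↦ x ^ 2)
      (fun x hx ↦ by simpa using sq_mul x hx 1 h1)
      (fun x _ y _ hxy ↦ by
        have : (x - y) ^ 2 = 0 := by
          simp only at hxy
          linear_combination hxy + (y ^ 2 - x * y) * h2
        exact sub_eq_zero.1 (pow_eq_zero_iff two_ne_zero |>.1 this)) a ha
    exact sq_mul c hc b hb
  · obtain ⟨c, hc, rfl⟩ := surj (fun x ↦ 2 * x)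
      (fun x hx ↦ by simpa using two_mul x hx 1 h1)
      (fun x _ y _ hxy ↦ mul_left_cancel₀ h2 hxy) a ha
    exact two_mul c hc b hb

/-- In the situation of `mul_mem_of_harmonic`, the subgroup is a subfield. -/
theorem exists_subfield_of_harmonic {K : Type*} [Field K] (A : AddSubgroup K)
    (hfin : (A : Set K).Finite) (h1 : (1 : K) ∈ A)
    (hA : ∀ a ∈ A, ∀ b ∈ A, a ≠ 0 → b ≠ 0 → a + b ≠ 0 → a * b / (a + b) ∈ A) :
    ∃ F : Subfield K, ∀ x, x ∈ F ↔ x ∈ A :=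
  have h := mul_mem_of_harmonic A hfin h1 hA
  ⟨{ carrier := A
     mul_mem' := fun ha hb ↦ h.2 _ ha _ hb
     one_mem' := h1
     add_mem' := A.add_mem
     zero_mem' := A.zero_mem
     neg_mem' := A.neg_mem
     inv_mem' := h.1 }, fun _ ↦ Iff.rfl⟩

/-- The properties of the conjugation of a quadratic field extension that are needed below. -/
structure QuadConj {C : Type*} [Field C] (R : Subfield C) (σ : C →+* C) : Prop where
  fix : ∀ r ∈ R, σ r = r
  invol : ∀ x, σ (σ x) = x
  trace : ∀ x, x + σ x ∈ R
  norm : ∀ x, σ x * x ∈ R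

/-- The affine part of a subunital of order `q` one of whose points is the point at infinity of the
vertical lines. -/
structure AffSubunital {C : Type*} [Field C] (R : Subfield C) (σ : C →+* C) (β : C) (q : ℕ)
    (P : Set (C × C)) : Prop where
  herm : ∀ p ∈ P, p.1 + β * (σ p.2 * p.2) ∈ R
  card : P.ncard = q ^ 3
  vert : ∀ p ∈ P, {y | (y, p.2) ∈ P}.ncard = q
  slope : ∀ m b, {p ∈ P | p.1 = m * p.2 + b}.Nontrivial →
    {p ∈ P | p.1 = m * p.2 + b}.ncard = q + 1

namespace AffSubunital

variable {C : Type*} [Field C] {R : Subfield C} {σ : C →+* C} {β : C} {q : ℕ} {P : Set (C × C)}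

theorem finite (h : AffSubunital R σ β q P) (hq : 2 ≤ q) : P.Finite :=
  Set.finite_of_ncard_ne_zero (by rw [h.card]; positivity)

theorem finite_vert (h : AffSubunital R σ β q P) (hq : 2 ≤ q) (z : C) :
    {y | (y, z) ∈ P}.Finite :=
  (h.finite hq).preimage (f := fun y ↦ (y, z)) (fun _ _ _ _ h ↦ (Prod.ext_iff.1 h).1)

theorem card_snd (h : AffSubunital R σ β q P) (hq : 2 ≤ q) : (Prod.snd '' P).ncard = q ^ 2 := by
  have h1 : P.ncard = (Prod.snd '' P).ncard * q :=
    Set.ncard_eq_ncard_image_mul (h.finite hq) fun p hp ↦ by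
      rw [← h.vert p hp, ← Set.ncard_image_of_injective {y | (y, p.2) ∈ P}
        (f := fun y ↦ (y, p.2)) (fun _ _ h ↦ (Prod.ext_iff.1 h).1)]
      congr 1
      ext ⟨y, z⟩
      simp only [Set.mem_ofPred_eq, Set.mem_image, Prod.mk.injEq]
      constructor
      · rintro ⟨h, rfl⟩; exact ⟨y, h, rfl, rfl⟩
      · rintro ⟨y', h, rfl, rfl⟩; exact ⟨h, rfl⟩
  rw [h.card] at h1
  have : 0 < q := by omega
  exact Nat.eq_of_mul_eq_mul_right this (by rw [← h1]; ring)

/-- The points on a line through a given point, other than that point. -/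
theorem card_slope (h : AffSubunital R σ β q P) {p p' : C × C} (hp : p ∈ P)
    (hp' : p' ∈ P) (hne : p'.2 ≠ p.2) {m : C} (hm : p'.1 - p.1 = m * (p'.2 - p.2)) :
    {x ∈ P | x.2 ≠ p.2 ∧ x.1 - p.1 = m * (x.2 - p.2)}.ncard = q := by
  have hn : {x ∈ P | x.1 = m * x.2 + (p.1 - m * p.2)}.ncard = q + 1 := by
    refine h.slope _ _ ⟨p, ⟨hp, by ring⟩, p', ⟨hp', by linear_combination hm⟩, fun e ↦ ?_⟩
    exact hne (by rw [e])
  have e : {x ∈ P | x.1 = m * x.2 + (p.1 - m * p.2)} =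
      insert p {x ∈ P | x.2 ≠ p.2 ∧ x.1 - p.1 = m * (x.2 - p.2)} := by
    ext x
    simp only [Set.mem_ofPred_eq, Set.mem_insert_iff]
    constructor
    · rintro ⟨hx, hx'⟩
      by_cases hxp : x.2 = p.2
      · exact Or.inl (Prod.ext (by rw [hx', hxp]; ring) hxp)
      · exact Or.inr ⟨hx, hxp, by rw [hx']; ring⟩
    · rintro (rfl | ⟨hx, -, hx'⟩)
      · exact ⟨hp, by ring⟩
      · exact ⟨hx, by linear_combination hx'⟩
  have hfin : {x ∈ P | x.2 ≠ p.2 ∧ x.1 - p.1 = m * (x.2 - p.2)}.Finite :=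
    (Set.finite_of_ncard_ne_zero (by rw [hn]; omega)).subset (e ▸ Set.subset_insert _ _)
  rw [e, Set.ncard_insert_of_notMem (by simp) hfin] at hn
  omega

/-- Distinct lines of the dual pencil meet in at most one point. -/
theorem snd_eq_of_two_slopes (hσ : QuadConj R σ) (hβ : β ∉ R) {z₀ z z' m m' : C} (hm : m ≠ m')
    (hz : z ≠ z₀) (hz' : z' ≠ z₀)
    (h₁ : m * (z - z₀) + β * (σ z * z - σ z₀ * z₀) ∈ R)
    (h₂ : m' * (z - z₀) + β * (σ z * z - σ z₀ * z₀) ∈ R)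
    (h₃ : m * (z' - z₀) + β * (σ z' * z' - σ z₀ * z₀) ∈ R)
    (h₄ : m' * (z' - z₀) + β * (σ z' * z' - σ z₀ * z₀) ∈ R) : z = z' := by
  have a := R.sub_mem h₁ h₂
  have b := R.sub_mem h₃ h₄
  have hm' := sub_ne_zero.2 hm
  have hz := sub_ne_zero.2 hz
  have hz' := sub_ne_zero.2 hz'
  obtain ⟨s, hs⟩ : ∃ s, s = (z - z₀) / (z' - z₀) := ⟨_, rfl⟩
  have hsR : s ∈ R := by
    have : s = (m * (z - z₀) + β * (σ z * z - σ z₀ * z₀) -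
      (m' * (z - z₀) + β * (σ z * z - σ z₀ * z₀))) / (m * (z' - z₀) + β * (σ z' * z' - σ z₀ * z₀)
      - (m' * (z' - z₀) + β * (σ z' * z' - σ z₀ * z₀))) := by
      rw [hs]
      have : ∀ u v : C, u * (z' - z₀) + v - (u * (z' - z₀) + v) = 0 := by intros; ring
      rw [show ∀ w v : C, m * w + v - (m' * w + v) = (m - m') * w by intros; ring,
        show ∀ w v : C, m * w + v - (m' * w + v) = (m - m') * w by intros; ring]
      field_simp
    rw [this]
    exact R.div_mem a b
  have hs0 : s ≠ 0 := by rw [hs]; exact div_ne_zero hz hz'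
  have hsσ := hσ.fix s hsR
  have hzs : z = z₀ + s * (z' - z₀) := by rw [hs]; field_simp; ring
  have key : β * (s * (1 - s) * (σ (z' - z₀) * (z' - z₀))) ∈ R := by
    have := R.sub_mem (R.mul_mem hsR h₃) h₁
    convert this using 1
    rw [hzs]
    simp only [map_add, map_sub, map_mul, hsσ]
    ring
  by_contra hne
  have hs1 : 1 - s ≠ 0 := by
    intro h
    apply hne
    rw [hzs, ← sub_eq_zero.1 h]; ring
  have hN : s * (1 - s) * (σ (z' - z₀) * (z' - z₀)) ≠ 0 :=
    mul_ne_zero (mul_ne_zero hs0 hs1) (mul_ne_zero ((map_ne_zero σ).2 hz') hz')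
  have hNR : s * (1 - s) * (σ (z' - z₀) * (z' - z₀)) ∈ R :=
    R.mul_mem (R.mul_mem hsR (R.sub_mem R.one_mem hsR)) (hσ.norm _)
  apply hβ
  have := R.div_mem key hNR
  rwa [mul_div_assoc, div_self hN, mul_one] at this

theorem translate_of_ne (h : AffSubunital R σ β q P) (hq : 2 ≤ q) (hσ : QuadConj R σ) (hβ : β ∉ R)
    {a b z₀ y z : C} (ha : (a, z₀) ∈ P) (hb : (b, z₀) ∈ P) (hy : (y, z) ∈ P) (hz : z ≠ z₀) :
    (y + b - a, z) ∈ P := by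
  classical
  -- `rich m`: the slope `m` occurs at `z` and for at least `q - 1` other values of `z`
  let line : C → C → Prop := fun m w ↦ m * (w - z₀) + β * (σ w * w - σ z₀ * z₀) ∈ R
  let rest : Set C := {w ∈ Prod.snd '' P | w ≠ z₀ ∧ w ≠ z}
  have hSfin : (Prod.snd '' P).Finite := (h.finite hq).image _
  have hrest_fin : rest.Finite := hSfin.subset (Set.sep_subset _ _)
  have hrest : rest.ncard + 2 = q ^ 2 := by
    have e : Prod.snd '' P = insert z₀ (insert z rest) := by
      ext w
      simp only [Set.mem_insert_iff, rest, Set.mem_ofPred_eq]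
      constructor
      · intro hw
        by_cases h1 : w = z₀
        · exact Or.inl h1
        by_cases h2 : w = z
        · exact Or.inr (Or.inl h2)
        exact Or.inr (Or.inr ⟨hw, h1, h2⟩)
      · rintro (rfl | rfl | hw)
        · exact ⟨_, ha, rfl⟩
        · exact ⟨_, hy, rfl⟩
        · exact hw.1
    rw [← h.card_snd hq, e, Set.ncard_insert_of_notMem _ (hrest_fin.insert _),
      Set.ncard_insert_of_notMem _ hrest_fin]
    · simp [rest]
    · simp [rest, hz.symm]
  have rich : ∀ c, (c, z₀) ∈ P → ∀ u, (u, z) ∈ P → line ((u - c) / (z - z₀)) z ∧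
      q ≤ {w ∈ rest | line ((u - c) / (z - z₀)) w}.ncard + 1 := by
    intro c hc u hu
    set m := (u - c) / (z - z₀) with hm
    have hmz : u - c = m * (z - z₀) := by
      rw [hm]; field_simp [sub_ne_zero.2 hz]
    have hline : ∀ x ∈ P, x.1 - c = m * (x.2 - z₀) → line m x.2 := by
      intro x hx hxm
      have := R.sub_mem (h.herm x hx) (h.herm _ hc)
      simp only at this
      convert this using 1
      rw [← hxm]; ring
    refine ⟨hline (u, z) hu hmz, ?_⟩
    have hcard := h.card_slope hc hu hz hmz
    rw [← hcard]
    have himg : Set.InjOn Prod.snd {x ∈ P | x.2 ≠ z₀ ∧ x.1 - c = m * (x.2 - z₀)} := by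
      rintro x ⟨-, -, hx⟩ x' ⟨-, -, hx'⟩ e
      refine Prod.ext ?_ e
      rw [e, ← hx'] at hx
      simpa using hx
    rw [← himg.ncard_image]
    refine le_trans (Set.ncard_le_ncard (t := insert z {w ∈ rest | line m w}) ?_
      ((hrest_fin.subset (Set.sep_subset _ _)).insert _)) (Set.ncard_insert_le _ _)
    rintro _ ⟨x, ⟨hx, hxz, hxm⟩, rfl⟩
    by_cases hxe : x.2 = z
    · exact Or.inl hxe
    · exact Or.inr ⟨⟨⟨x, hx, rfl⟩, hxz, hxe⟩, hline x hx hxm⟩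
  by_contra hcon
  let T : Set C := {u | (u, z) ∈ P}
  have hTfin : T.Finite := h.finite_vert hq z
  have hTcard : T.ncard = q := h.vert _ hy
  let X : Set C := insert ((y - a) / (z - z₀)) ((fun u ↦ (u - b) / (z - z₀)) '' T)
  have hXfin : X.Finite := (hTfin.image _).insert _
  have hXcard : X.ncard = q + 1 := by
    rw [Set.ncard_insert_of_notMem _ (hTfin.image _), Set.InjOn.ncard_image, hTcard]
    · intro u _ u' _ e
      simpa [div_left_inj' (sub_ne_zero.2 hz)] using e
    · rintro ⟨u, hu, e⟩
      rw [div_left_inj' (sub_ne_zero.2 hz)] at e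
      apply hcon
      rwa [show y + b - a = u by linear_combination -e]
  have hXrich : ∀ m ∈ X, line m z ∧ q ≤ {w ∈ rest | line m w}.ncard + 1 := by
    rintro m (rfl | ⟨u, hu, rfl⟩)
    · exact rich a ha y hy
    · exact rich b hb u hu
  have hdisj : (hXfin.toFinset : Set C).PairwiseDisjoint fun m ↦
      hrest_fin.toFinset.filter (line m) := by
    intro m hm m' hm' hne
    refine Finset.disjoint_left.2 fun w hw hw' ↦ ?_
    simp only [Finset.mem_filter, Set.Finite.mem_toFinset] at hw hw'
    rw [Set.Finite.coe_toFinset] at hm hm'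
    exact hw.1.2.2 (snd_eq_of_two_slopes hσ hβ hne hw.1.2.1 hz hw.2 hw'.2
      (hXrich m hm).1 (hXrich m' hm').1)
  have hle := Finset.card_le_card (Finset.biUnion_subset.2 fun m (_ : m ∈ hXfin.toFinset) ↦
    Finset.filter_subset (line m) hrest_fin.toFinset)
  rw [Finset.card_biUnion hdisj, ← Set.ncard_eq_toFinset_card _ hrest_fin] at hle
  have hge : ∀ m ∈ hXfin.toFinset, q - 1 ≤ (hrest_fin.toFinset.filter (line m)).card := by
    intro m hm
    have := (hXrich m (hXfin.mem_toFinset.1 hm)).2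
    rw [Nat.sub_le_iff_le_add]
    refine this.trans_eq ?_
    rw [← Set.ncard_coe_finset]
    simp
  have hsum := Finset.card_nsmul_le_sum _ _ _ hge
  rw [← Set.ncard_eq_toFinset_card _ hXfin, hXcard, smul_eq_mul] at hsum
  obtain ⟨n, rfl⟩ : ∃ n, q = n + 1 := ⟨q - 1, by omega⟩
  simp only [Nat.add_sub_cancel] at hsum
  nlinarith

/-- The affine part of a subunital is invariant under the vertical translations joining two of its
points. -/
theorem translate (h : AffSubunital R σ β q P) (hq : 2 ≤ q) (hσ : QuadConj R σ) (hβ : β ∉ R)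
    {a b z₀ y z : C} (ha : (a, z₀) ∈ P) (hb : (b, z₀) ∈ P) (hy : (y, z) ∈ P) :
    (y + b - a, z) ∈ P := by
  by_cases hz : z = z₀
  · subst hz
    obtain ⟨_, ⟨⟨y', z'⟩, hy', rfl⟩, hz'⟩ : ∃ w ∈ Prod.snd '' P, w ≠ z := by
      by_contra! hcon
      have := Set.ncard_le_ncard (t := {z}) hcon
      rw [h.card_snd hq, Set.ncard_singleton] at this
      nlinarith
    have h1 := h.translate_of_ne hq hσ hβ ha hb hy' hz'
    have h2 := h.translate_of_ne hq hσ hβ hy' h1 hy (Ne.symm hz')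
    convert h2 using 2
    ring
  · exact h.translate_of_ne hq hσ hβ ha hb hy hz

end AffSubunital

/-- The vector `v` is nonzero and represents a point of `U`. -/
def Represents {C : Type*} [Field C] (U : Set (Projectivization C (Fin 3 → C)))
    (v : Fin 3 → C) : Prop :=
  ∃ hv : v ≠ 0, Projectivization.mk C v hv ∈ U

/-- The affine part of a set of points. -/
def affinePart {C : Type*} [Field C] (U : Set (Projectivization C (Fin 3 → C))) : Set (C × C) :=
  {p | Represents U ![1, p.1, p.2]}

/-- A set of `q ^ 3 + 1` points such that every line meeting it in at least two points meets it in
exactly `q + 1` points. -/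
structure LineUnital {C : Type*} [Field C] (q : ℕ)
    (U : Set (Projectivization C (Fin 3 → C))) : Prop where
  card : U.ncard = q ^ 3 + 1
  line : ∀ f : (Fin 3 → C) →ₗ[C] C, f ≠ 0 → {P ∈ U | f P.rep = 0}.Nontrivial →
    {P ∈ U | f P.rep = 0}.ncard = q + 1

/-- A subunital of order `q` of the unital given by the form `σ(X)·Y + β·σ(Z)·Z` with values
in `R`. -/
structure ProjSubunital {C : Type*} [Field C] (R : Subfield C) (σ : C →+* C) (β : C) (q : ℕ)
    (U : Set (Projectivization C (Fin 3 → C))) : Prop extends LineUnital q U where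
  herm : ∀ v, Represents U v → σ (v 0) * v 1 + β * (σ (v 2) * v 2) ∈ R

section Represents

variable {C : Type*} [Field C] {U : Set (Projectivization C (Fin 3 → C))} {v : Fin 3 → C}

theorem Projectivization.apply_rep_eq_zero_iff (f : (Fin 3 → C) →ₗ[C] C) (hv : v ≠ 0) :
    f (Projectivization.mk C v hv).rep = 0 ↔ f v = 0 := by
  obtain ⟨a, ha⟩ := Projectivization.exists_smul_eq_mk_rep C v hv
  rw [← ha, Units.smul_def, map_smul, smul_eq_mul, mul_eq_zero, or_iff_right a.ne_zero]

theorem represents_smul_iff {c : C} (hc : c ≠ 0) : Represents U (c • v) ↔ Represents U v := by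
  have : ∀ {c : C} {v}, c ≠ 0 → Represents U v → Represents U (c • v) := by
    rintro c v hc ⟨hv, h⟩
    refine ⟨smul_ne_zero hc hv, ?_⟩
    convert h using 1
    exact (Projectivization.mk_eq_mk_iff' _ _ _ _ _).2 ⟨c, rfl⟩
  refine ⟨fun h ↦ ?_, this hc⟩
  simpa [smul_smul, inv_mul_cancel₀ hc] using this (inv_ne_zero hc) h

theorem represents_map_iff (L : (Fin 3 → C) ≃ₗ[C] (Fin 3 → C)) :
    Represents (Projectivization.map L.toLinearMap L.injective '' U) v ↔
      Represents U (L.symm v) := by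
  constructor
  · rintro ⟨hv, P, hP, e⟩
    induction P using Projectivization.ind with | h w hw => ?_
    rw [Projectivization.map_mk] at e
    obtain ⟨c, hc⟩ := (Projectivization.mk_eq_mk_iff' _ _ _ _ _).1 e
    have hc' : c • v = L w := hc
    have hc0 : c ≠ 0 := by
      rintro rfl
      rw [zero_smul] at hc'
      exact hw (by simpa using hc'.symm)
    rw [← represents_smul_iff hc0, ← map_smul, hc', L.symm_apply_apply]
    exact ⟨hw, hP⟩
  · rintro ⟨hw, hP⟩
    refine ⟨fun h ↦ hw (by simp [h]), _, hP, ?_⟩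
    rw [Projectivization.map_mk]
    simp

end Represents

theorem LineUnital.map {C : Type*} [Field C] {q : ℕ} {U : Set (Projectivization C (Fin 3 → C))}
    (h : LineUnital q U) (L : (Fin 3 → C) ≃ₗ[C] (Fin 3 → C)) :
    LineUnital q (Projectivization.map L.toLinearMap L.injective '' U) where
  card := by
    rw [Set.ncard_image_of_injective _ (Projectivization.map_injective (τ := RingHom.id C) _ _),
      h.card]
  line f hf hn := by
    have hinj := Projectivization.map_injective (τ := RingHom.id C) L.toLinearMap L.injective
    have e : {P ∈ Projectivization.map L.toLinearMap L.injective '' U | f P.rep = 0} =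
        Projectivization.map L.toLinearMap L.injective ''
          {P ∈ U | (f ∘ₗ L.toLinearMap) P.rep = 0} := by
      have key : ∀ P, f (Projectivization.map L.toLinearMap L.injective P).rep = 0 ↔
          (f ∘ₗ L.toLinearMap) P.rep = 0 := by
        intro P
        induction P using Projectivization.ind with | h w hw => ?_
        rw [Projectivization.map_mk, Projectivization.apply_rep_eq_zero_iff,
          Projectivization.apply_rep_eq_zero_iff]
        rfl
      ext P
      constructor
      · rintro ⟨⟨Q, hQ, rfl⟩, hP⟩
        exact ⟨Q, ⟨hQ, (key Q).1 hP⟩, rfl⟩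
      · rintro ⟨Q, ⟨hQ, hP⟩, rfl⟩
        exact ⟨⟨Q, hQ, rfl⟩, (key Q).2 hP⟩
    rw [e] at hn ⊢
    rw [Set.ncard_image_of_injective _ hinj]
    refine h.line _ (fun h0 ↦ hf ?_) (Set.nontrivial_of_image _ _ hn)
    ext v
    simpa using LinearMap.congr_fun h0 (L.symm (Pi.single v 1))

namespace ProjSubunital

variable {C : Type*} [Field C] {R : Subfield C} {σ : C →+* C} {β : C} {q : ℕ}
  {U : Set (Projectivization C (Fin 3 → C))}

theorem map (h : ProjSubunital R σ β q U) {β' : C} (L : (Fin 3 → C) ≃ₗ[C] (Fin 3 → C))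
    (hL : ∀ v : Fin 3 → C, σ (v 0) * v 1 + β * (σ (v 2) * v 2) ∈ R →
      σ (L v 0) * L v 1 + β' * (σ (L v 2) * L v 2) ∈ R) :
    ProjSubunital R σ β' q (Projectivization.map L.toLinearMap L.injective '' U) where
  herm v hv := by simpa using hL _ (h.herm _ ((represents_map_iff L).1 hv))
  toLineUnital := h.toLineUnital.map L

theorem finite (h : ProjSubunital R σ β q U) : U.Finite :=
  Set.finite_of_ncard_ne_zero (by rw [h.card]; omega)

theorem snd_eq_zero (h : ProjSubunital R σ β q U) (hσ : QuadConj R σ) (hβ : β ∉ R) {v : Fin 3 → C}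
    (hv : Represents U v) (h0 : v 0 = 0) : v 2 = 0 := by
  by_contra h2
  have := h.herm v hv
  rw [h0, map_zero, zero_mul, zero_add] at this
  have hN : σ (v 2) * v 2 ≠ 0 := mul_ne_zero ((map_ne_zero σ).2 h2) h2
  apply hβ
  have := R.div_mem this (hσ.norm (v 2))
  rwa [mul_div_assoc, div_self hN, mul_one] at this

/-- A representative of a point of `U` is proportional to `(0, 1, 0)` or to an affine point. -/
theorem cases (h : ProjSubunital R σ β q U) (hσ : QuadConj R σ) (hβ : β ∉ R) {v : Fin 3 → C}
    (hv : Represents U v) : (∃ c : C, c ≠ 0 ∧ v = c • ![0, 1, 0]) ∨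
      ∃ c : C, c ≠ 0 ∧ ∃ p ∈ affinePart U, v = c • ![1, p.1, p.2] := by
  by_cases h0 : v 0 = 0
  · have h2 := h.snd_eq_zero hσ hβ hv h0
    have e : v = v 1 • ![0, 1, 0] := by
      ext i; fin_cases i <;> simp [h0, h2]
    refine Or.inl ⟨v 1, fun h1 ↦ hv.1 ?_, e⟩
    rw [e, h1, zero_smul]
  · have e : v = v 0 • ![1, v 1 / v 0, v 2 / v 0] := by
      ext i; fin_cases i <;> simp <;> field_simp
    refine Or.inr ⟨v 0, h0, (v 1 / v 0, v 2 / v 0), ?_, e⟩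
    rw [e, represents_smul_iff h0] at hv
    exact hv

theorem affine (h : ProjSubunital R σ β q U) (hσ : QuadConj R σ) (hβ : β ∉ R)
    (hinf : Represents U ![0, 1, 0]) : AffSubunital R σ β q (affinePart U) := by
  have hne : ∀ p : C × C, ![1, p.1, p.2] ≠ 0 := fun p e ↦ by simpa using congr_fun e 0
  let g : C × C → Projectivization C (Fin 3 → C) := fun p ↦ Projectivization.mk C _ (hne p)
  have hg : Function.Injective g := by
    intro p p' e
    obtain ⟨c, hc⟩ := (Projectivization.mk_eq_mk_iff' _ _ _ _ _).1 e
    have h0 := congr_fun hc 0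
    have h1 := congr_fun hc 1
    have h2 := congr_fun hc 2
    simp at h0 h1 h2
    subst h0
    exact Prod.ext (by simpa using h1.symm) (by simpa using h2.symm)
  obtain ⟨hi0, hi⟩ := hinf
  have hinfg : ∀ p, g p ≠ Projectivization.mk C _ hi0 := by
    intro p e
    obtain ⟨c, hc⟩ := (Projectivization.mk_eq_mk_iff' _ _ _ _ _).1 e
    simpa using congr_fun hc 0
  have hU : U = insert (Projectivization.mk C _ hi0) (g '' affinePart U) := by
    ext P
    constructor
    · induction P using Projectivization.ind with | h v hv => ?_
      intro hP
      rcases h.cases hσ hβ ⟨hv, hP⟩ with ⟨c, -, e⟩ | ⟨c, -, p, hp, e⟩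
      · exact Or.inl ((Projectivization.mk_eq_mk_iff' _ _ _ _ _).2 ⟨c, e.symm⟩)
      · exact Or.inr ⟨p, hp, Eq.symm <| (Projectivization.mk_eq_mk_iff' _ _ _ _ _).2 ⟨c, e.symm⟩⟩
    · rintro (rfl | ⟨p, ⟨_, hp⟩, rfl⟩)
      · exact hi
      · exact hp
  have hfin : (affinePart U).Finite :=
    Set.Finite.of_finite_image (h.finite.subset ((Set.subset_insert _ _).trans hU.ge))
      hg.injOn
  refine ⟨fun p hp ↦ by simpa using h.herm _ hp, ?_, fun p hp ↦ ?_, fun m b hn ↦ ?_⟩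
  · have hc := h.card
    rw [hU, Set.ncard_insert_of_notMem _ (hfin.image g), Set.ncard_image_of_injective _ hg] at hc
    · simpa using hc
    · rintro ⟨p, -, e⟩
      exact hinfg p e
  · let f : (Fin 3 → C) →ₗ[C] C := LinearMap.proj 2 - p.2 • LinearMap.proj 0
    have hf : ∀ v, f v = v 2 - p.2 * v 0 := fun v ↦ rfl
    have hf0 : f ≠ 0 := fun e ↦ by
      have := LinearMap.congr_fun e ![0, 0, 1]
      simp [hf] at this
    have e : {P ∈ U | f P.rep = 0} =
        insert (Projectivization.mk C _ hi0)
          ((fun y ↦ g (y, p.2)) '' {y | (y, p.2) ∈ affinePart U}) := by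
      ext P
      constructor
      · rintro ⟨hP, hfP⟩
        rw [hU] at hP
        rcases hP with rfl | ⟨x, hx, rfl⟩
        · exact Or.inl rfl
        · rw [Projectivization.apply_rep_eq_zero_iff, hf] at hfP
          have hx2 : x = (x.1, p.2) := Prod.ext rfl (by simpa [sub_eq_zero] using hfP)
          rw [hx2] at hx ⊢
          exact Or.inr ⟨x.1, hx, rfl⟩
      · rintro (rfl | ⟨y, hy, rfl⟩)
        · exact ⟨hi, by rw [Projectivization.apply_rep_eq_zero_iff, hf]; simp⟩
        · exact ⟨hy.2, by rw [Projectivization.apply_rep_eq_zero_iff, hf]; simp⟩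
    have hc := h.line f hf0
    have hinj : Function.Injective fun y ↦ g (y, p.2) := fun y y' e ↦ (Prod.ext_iff.1 (hg e)).1
    rw [e] at hc
    have hfin' : {y | (y, p.2) ∈ affinePart U}.Finite :=
      hfin.preimage (f := fun y ↦ (y, p.2)) (fun _ _ _ _ h ↦ (Prod.ext_iff.1 h).1)
    rw [Set.ncard_insert_of_notMem _ (hfin'.image _), Set.ncard_image_of_injective _ hinj] at hc
    · exact Nat.succ_injective (hc ⟨_, Or.inl rfl, g p, Or.inr ⟨p.1, hp, rfl⟩, (hinfg p).symm⟩)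
    · rintro ⟨y, -, e⟩
      exact hinfg _ e
  · let f : (Fin 3 → C) →ₗ[C] C :=
      LinearMap.proj 1 - m • LinearMap.proj 2 - b • LinearMap.proj 0
    have hf : ∀ v, f v = v 1 - m * v 2 - b * v 0 := fun v ↦ rfl
    have hf0 : f ≠ 0 := fun e ↦ by
      have := LinearMap.congr_fun e ![0, 1, 0]
      simp [hf] at this
    have e : {P ∈ U | f P.rep = 0} = g '' {p ∈ affinePart U | p.1 = m * p.2 + b} := by
      ext P
      constructor
      · rintro ⟨hP, hfP⟩
        rw [hU] at hP
        rcases hP with rfl | ⟨x, hx, rfl⟩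
        · rw [Projectivization.apply_rep_eq_zero_iff, hf] at hfP
          simp at hfP
        · rw [Projectivization.apply_rep_eq_zero_iff, hf] at hfP
          simp only [Matrix.cons_val] at hfP
          exact ⟨x, ⟨hx, by linear_combination hfP⟩, rfl⟩
      · rintro ⟨x, ⟨hx, hx'⟩, rfl⟩
        refine ⟨hx.2, ?_⟩
        rw [Projectivization.apply_rep_eq_zero_iff, hf]
        simp only [Matrix.cons_val]
        linear_combination hx'
    have hc := h.line f hf0
    rw [e, Set.ncard_image_of_injective _ hg] at hc
    exact hc (hn.image hg)

end ProjSubunital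

section Collineations

variable {C : Type*} [Field C]

/-- The diagonal collineation with entries `d`. -/
def diagEquiv (d : Fin 3 → C) (hd : ∀ i, d i ≠ 0) : (Fin 3 → C) ≃ₗ[C] (Fin 3 → C) :=
  LinearEquiv.piCongrRight fun i ↦ LinearEquiv.smulOfNeZero C C (d i) (hd i)

theorem diagEquiv_apply (d : Fin 3 → C) (hd : ∀ i, d i ≠ 0) (v : Fin 3 → C) (i : Fin 3) :
    diagEquiv d hd v i = d i * v i := rfl

theorem diagEquiv_symm_apply (d : Fin 3 → C) (hd : ∀ i, d i ≠ 0) (v : Fin 3 → C) (i : Fin 3) :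
    (diagEquiv d hd).symm v i = (d i)⁻¹ * v i := rfl

/-- The collineation `(y, z) ↦ (y - a + c (z - b), z - b)` of the affine plane. -/
def shearEquiv (a b c : C) : (Fin 3 → C) ≃ₗ[C] (Fin 3 → C) where
  toFun v := ![v 0, v 1 - a * v 0 + c * (v 2 - b * v 0), v 2 - b * v 0]
  invFun v := ![v 0, v 1 + a * v 0 - c * v 2, v 2 + b * v 0]
  map_add' v w := by ext i; fin_cases i <;> simp <;> ring
  map_smul' r v := by ext i; fin_cases i <;> simp <;> ring
  left_inv v := by ext i; fin_cases i <;> simp; ring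
  right_inv v := by ext i; fin_cases i <;> simp; ring

theorem shearEquiv_apply (a b c : C) (v : Fin 3 → C) :
    shearEquiv a b c v = ![v 0, v 1 - a * v 0 + c * (v 2 - b * v 0), v 2 - b * v 0] := rfl

theorem shearEquiv_symm_apply (a b c : C) (v : Fin 3 → C) :
    (shearEquiv a b c).symm v = ![v 0, v 1 + a * v 0 - c * v 2, v 2 + b * v 0] := rfl

/-- The collineation interchanging the first two coordinates. -/
def swapEquiv (C : Type*) [Field C] : (Fin 3 → C) ≃ₗ[C] (Fin 3 → C) :=
  LinearEquiv.funCongrLeft C C (Equiv.swap 0 1)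

theorem swapEquiv_apply (v : Fin 3 → C) : swapEquiv C v = ![v 1, v 0, v 2] := by
  ext i; fin_cases i <;> rfl

theorem swapEquiv_symm_apply (v : Fin 3 → C) : (swapEquiv C).symm v = ![v 1, v 0, v 2] := by
  rw [LinearEquiv.symm_apply_eq, swapEquiv_apply]
  ext i; fin_cases i <;> rfl

end Collineations

theorem QuadConj.notMem {C : Type*} [Field C] {R : Subfield C} {σ : C →+* C}
    (hσ : QuadConj R σ) {β : C} (hβ : β ∉ R) : σ β ∉ R := fun h ↦ hβ <| by
  rwa [← hσ.invol β, hσ.fix _ h]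

namespace ProjSubunital

variable {C : Type*} [Field C] {R : Subfield C} {σ : C →+* C} {β : C} {q : ℕ}
  {U : Set (Projectivization C (Fin 3 → C))}

theorem swap (h : ProjSubunital R σ β q U) (hσ : QuadConj R σ) :
    ProjSubunital R σ (σ β) q
      (Projectivization.map (swapEquiv C).toLinearMap (swapEquiv C).injective '' U) := by
  refine h.map _ fun v hv ↦ ?_
  have := hσ.fix _ hv
  rw [swapEquiv_apply]
  rw [← this] at hv
  simp only [map_add, map_mul, hσ.invol] at hv
  simp only [Matrix.cons_val]
  convert hv using 1
  ring

theorem shear (h : ProjSubunital R σ β q U) (hσ : QuadConj R σ) {p : C × C}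
    (hp : p ∈ affinePart U) :
    ProjSubunital R σ β q (Projectivization.map
      (shearEquiv p.1 p.2 ((β - σ β) * σ p.2)).toLinearMap (LinearEquiv.injective _) '' U) := by
  refine h.map _ fun v hv ↦ ?_
  have h1 := h.herm _ hp
  simp only [Matrix.cons_val, map_one, one_mul] at h1
  have h2 := R.mul_mem (hσ.norm (v 0)) h1
  have h3 := hσ.trace (σ β * (σ (v 0) * σ p.2 * v 2))
  have h4 := R.mul_mem (hσ.trace β) (R.mul_mem (hσ.norm (v 0)) (hσ.norm p.2))
  convert R.add_mem (R.sub_mem (R.sub_mem hv h2) h3) h4 using 1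
  rw [shearEquiv_apply]
  simp only [Matrix.cons_val, map_sub, map_mul, hσ.invol]
  ring

/-- Diagonal collineations that map `(g, 0)` to `(1, 0)` and `s` to `1` in the last coordinate. -/
theorem diag (h : ProjSubunital R σ β q U) {g s : C} (hg : g ∈ R)
    (hd : ∀ i, ![1, g⁻¹, s⁻¹] i ≠ 0) :
    ProjSubunital R σ (β * (σ s * s) / g) q
      (Projectivization.map (diagEquiv _ hd).toLinearMap (LinearEquiv.injective _) '' U) := by
  refine h.map _ fun v hv ↦ ?_
  have hg0 : g ≠ 0 := by simpa using hd 1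
  have hs0 : s ≠ 0 := by simpa using hd 2
  have hs0' : σ s ≠ 0 := (map_ne_zero σ).2 hs0
  convert R.div_mem hv hg using 1
  simp only [diagEquiv_apply, Matrix.cons_val, map_mul, map_inv₀, one_mul]
  field_simp

theorem translate (h : ProjSubunital R σ β q U) (hq : 2 ≤ q) (hσ : QuadConj R σ) (hβ : β ∉ R)
    (hinf : Represents U ![0, 1, 0])
    {a b z₀ y z : C} (ha : (a, z₀) ∈ affinePart U) (hb : (b, z₀) ∈ affinePart U)
    (hy : (y, z) ∈ affinePart U) : (y + b - a, z) ∈ affinePart U :=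
  (h.affine hσ hβ hinf).translate hq hσ hβ ha hb hy

/-- Invariance under the elations with center `(0, 0)`. -/
theorem translate_zero (h : ProjSubunital R σ β q U) (hq : 2 ≤ q) (hσ : QuadConj R σ) (hβ : β ∉ R)
    (hinf : Represents U ![0, 1, 0]) (h0 : (0, 0) ∈ affinePart U)
    {g y z : C} (hg : (g, 0) ∈ affinePart U) (hg0 : g ≠ 0) (hy : (y, z) ∈ affinePart U)
    (hy0 : y ≠ 0) (hyg : y + g ≠ 0) :
    (y * g / (y + g), z * g / (y + g)) ∈ affinePart U := by
  have key : ∀ {u w c : C}, c ≠ 0 → ((u, w) ∈ affinePart (Projectivization.map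
      (swapEquiv C).toLinearMap (swapEquiv C).injective '' U) ↔
      Represents U ![c * u, c, c * w]) := by
    intro u w c hc
    change Represents _ _ ↔ _
    rw [represents_map_iff, swapEquiv_symm_apply, ← represents_smul_iff hc]
    congr! 1
    ext i; fin_cases i <;> simp
  have hinf' : Represents (Projectivization.map
      (swapEquiv C).toLinearMap (swapEquiv C).injective '' U) ![0, 1, 0] := by
    rw [represents_map_iff, swapEquiv_symm_apply]
    simpa using show Represents U ![1, 0, 0] from h0
  have ha : (0, 0) ∈ affinePart (Projectivization.map
      (swapEquiv C).toLinearMap (swapEquiv C).injective '' U) := by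
    rw [key one_ne_zero]
    simpa using hinf
  have hb : (g⁻¹, 0) ∈ affinePart (Projectivization.map
      (swapEquiv C).toLinearMap (swapEquiv C).injective '' U) := by
    rw [key hg0, mul_inv_cancel₀ hg0, mul_zero]
    exact hg
  have hy' : (y⁻¹, z / y) ∈ affinePart (Projectivization.map
      (swapEquiv C).toLinearMap (swapEquiv C).injective '' U) := by
    rw [key hy0, mul_inv_cancel₀ hy0, mul_div_cancel₀ _ hy0]
    exact hy
  have := (h.swap hσ).translate hq hσ (hσ.notMem hβ) hinf' ha hb hy'
  rw [key (div_ne_zero (mul_ne_zero hy0 hg0) hyg)] at this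
  change Represents _ _
  convert this using 2
  · field_simp
    ring
  · congr 2
    field_simp

end ProjSubunital

/-- The elements `a + b η` with `a, b ∈ F`. -/
def pairSpan {C : Type*} [Field C] (F : Subfield C) (η : C) : AddSubgroup C where
  carrier := {x | ∃ a ∈ F, ∃ b ∈ F, x = a + b * η}
  zero_mem' := ⟨0, F.zero_mem, 0, F.zero_mem, by simp⟩
  add_mem' := by
    rintro _ _ ⟨a, ha, b, hb, rfl⟩ ⟨a', ha', b', hb', rfl⟩
    exact ⟨_, F.add_mem ha ha', _, F.add_mem hb hb', by ring⟩
  neg_mem' := by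
    rintro _ ⟨a, ha, b, hb, rfl⟩
    exact ⟨_, F.neg_mem ha, _, F.neg_mem hb, by ring⟩

theorem mem_pairSpan {C : Type*} [Field C] {F : Subfield C} {η x : C} :
    x ∈ pairSpan F η ↔ ∃ a ∈ F, ∃ b ∈ F, x = a + b * η := Iff.rfl

theorem ncard_pairSpan {C : Type*} [Field C] {F R : Subfield C} (hFR : F ≤ R) {η : C}
    (hη : η ∉ R) : (pairSpan F η : Set C).ncard = (F : Set C).ncard ^ 2 := by
  have e : (pairSpan F η : Set C) = (fun x : C × C ↦ x.1 + x.2 * η) '' ((F : Set C) ×ˢ F) := by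
    ext x
    simp only [SetLike.mem_coe, mem_pairSpan, Set.mem_image, Set.mem_prod, Prod.exists]
    constructor
    · rintro ⟨a, ha, b, hb, rfl⟩; exact ⟨a, b, ⟨ha, hb⟩, rfl⟩
    · rintro ⟨a, b, ⟨ha, hb⟩, rfl⟩; exact ⟨a, ha, b, hb, rfl⟩
  rw [e, Set.InjOn.ncard_image, Set.ncard_prod, sq]
  rintro ⟨a, b⟩ ⟨ha, hb⟩ ⟨a', b'⟩ ⟨ha', hb'⟩ h
  simp only at h ha hb ha' hb'
  have hbb : b = b' := by
    by_contra hne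
    apply hη
    have : η = (a' - a) / (b - b') := by
      rw [eq_div_iff (sub_ne_zero.2 hne)]
      linear_combination h
    rw [this]
    exact R.div_mem (R.sub_mem (hFR ha') (hFR ha)) (R.sub_mem (hFR hb) (hFR hb'))
  subst hbb
  simpa using h

/-- A subunital with `(0, 1, 0)` and `(1, 0, 0)` among its points. -/
structure PointedSubunital {C : Type*} [Field C] (R : Subfield C) (σ : C →+* C) (β : C) (q : ℕ)
    (U : Set (Projectivization C (Fin 3 → C))) : Prop extends ProjSubunital R σ β q U where
  two_le : 2 ≤ q
  conj : QuadConj R σ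
  notMem : β ∉ R
  inf : Represents U ![0, 1, 0]
  zero : (0, 0) ∈ affinePart U

/-- A pointed subunital that also contains the affine points `(1, 0)` and `(η, 1)`. -/
structure NormSubunital {C : Type*} [Field C] (R : Subfield C) (σ : C →+* C) (β η : C) (q : ℕ)
    (U : Set (Projectivization C (Fin 3 → C))) : Prop extends PointedSubunital R σ β q U where
  one : (1, 0) ∈ affinePart U
  eta : (η, 1) ∈ affinePart U

namespace PointedSubunital

variable {C : Type*} [Field C] {R : Subfield C} {σ : C →+* C} {β : C} {q : ℕ}
  {U : Set (Projectivization C (Fin 3 → C))}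

theorem aff (h : PointedSubunital R σ β q U) : AffSubunital R σ β q (affinePart U) :=
  h.affine h.conj h.notMem h.inf

theorem finite_affinePart (h : PointedSubunital R σ β q U) : (affinePart U).Finite :=
  h.aff.finite h.two_le

/-- The affine points on the line joining `(0, 0)` to the point at infinity. -/
def vertical (h : PointedSubunital R σ β q U) : AddSubgroup C where
  carrier := {y | (y, 0) ∈ affinePart U}
  zero_mem' := h.zero
  add_mem' {a b} ha hb := by
    simpa using h.aff.translate h.two_le h.conj h.notMem h.zero hb ha
  neg_mem' {a} ha := by
    simpa using h.aff.translate h.two_le h.conj h.notMem ha h.zero h.zero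

theorem ncard_vertical (h : PointedSubunital R σ β q U) : (h.vertical : Set C).ncard = q :=
  (congrArg Set.ncard (Set.ext fun _ ↦ Iff.rfl)).trans (h.aff.vert (0, 0) h.zero)

theorem mem_of_mem_vertical (h : PointedSubunital R σ β q U) {y : C} (hy : y ∈ h.vertical) :
    y ∈ R := by
  simpa using h.aff.herm _ hy

theorem finite_vertical (h : PointedSubunital R σ β q U) : (h.vertical : Set C).Finite :=
  h.aff.finite_vert h.two_le 0

theorem add_mem (h : PointedSubunital R σ β q U) {g y z : C} (hg : (g, 0) ∈ affinePart U)
    (hy : (y, z) ∈ affinePart U) : (y + g, z) ∈ affinePart U := by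
  simpa using h.aff.translate h.two_le h.conj h.notMem h.zero hg hy

theorem elation (h : PointedSubunital R σ β q U) {g y z : C} (hg : (g, 0) ∈ affinePart U)
    (hg0 : g ≠ 0) (hy : (y, z) ∈ affinePart U) (hy0 : y ≠ 0) (hyg : y + g ≠ 0) :
    (y * g / (y + g), z * g / (y + g)) ∈ affinePart U :=
  h.translate_zero h.two_le h.conj h.notMem h.inf h.zero hg hg0 hy hy0 hyg

theorem fst_notMem (h : PointedSubunital R σ β q U) {y z : C} (hy : (y, z) ∈ affinePart U)
    (hz : z ≠ 0) : y ∉ R := fun hR ↦ h.notMem <| by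
  have h1 := R.sub_mem (h.aff.herm _ hy) hR
  have h2 : σ z * z ≠ 0 := mul_ne_zero ((map_ne_zero σ).2 hz) hz
  have h3 := R.div_mem h1 (h.conj.norm z)
  simpa [mul_div_assoc, div_self h2] using h3

theorem ncard_slopes (h : PointedSubunital R σ β q U) :
    ((fun p : C × C ↦ p.1 / p.2) '' {p ∈ affinePart U | p.2 ≠ 0}).ncard + 1 = q ^ 2 := by
  have hq := h.two_le
  have hfin := h.finite_affinePart
  have h1 : {p ∈ affinePart U | p.2 ≠ 0}.ncard =
      ((fun p : C × C ↦ p.1 / p.2) '' {p ∈ affinePart U | p.2 ≠ 0}).ncard * q := by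
    refine Set.ncard_eq_ncard_image_mul (hfin.subset fun _ h ↦ h.1) fun p hp ↦ ?_
    have hp2 : p.2 ≠ 0 := hp.2
    rw [← h.aff.card_slope h.zero hp.1 hp2 (m := p.1 / p.2) (by simp [div_mul_cancel₀ _ hp2])]
    congr 1
    ext x
    constructor
    · rintro ⟨⟨hx, hx2⟩, e⟩
      refine ⟨hx, hx2, ?_⟩
      rw [← e]
      simp [div_mul_cancel₀ _ hx2]
    · rintro ⟨hx, hx2, e⟩
      refine ⟨⟨hx, hx2⟩, ?_⟩
      simp only [sub_zero] at e hx2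
      simp only [e, mul_div_cancel_right₀ _ hx2]
  have h2 : {p ∈ affinePart U | p.2 = 0}.ncard = q := by
    rw [← h.aff.vert _ h.zero, ← Set.ncard_image_of_injective {y | (y, (0 : C)) ∈ affinePart U}
        (f := fun y ↦ (y, (0 : C))) (fun _ _ h ↦ (Prod.ext_iff.1 h).1)]
    congr 1
    ext ⟨y, z⟩
    constructor
    · rintro ⟨hy, hz⟩
      simp only at hz
      subst hz
      exact ⟨y, hy, rfl⟩
    · rintro ⟨y, hy, e⟩
      cases e
      exact ⟨hy, rfl⟩
  have h3 : {p ∈ affinePart U | p.2 ≠ 0}.ncard + {p ∈ affinePart U | p.2 = 0}.ncard = q ^ 3 := by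
    rw [← h.aff.card, ← Set.ncard_union_eq _ (hfin.subset fun _ h ↦ h.1)
      (hfin.subset fun _ h ↦ h.1)]
    · congr 1
      ext p
      by_cases hp : p.2 = 0 <;> simp [hp]
    · exact Set.disjoint_left.2 fun p hp hp' ↦ hp.2 hp'.2
  rw [h1, h2] at h3
  have : 0 < q := by omega
  refine Nat.eq_of_mul_eq_mul_right this ?_
  rw [add_mul, one_mul, h3]
  ring

end PointedSubunital

namespace NormSubunital

variable {C : Type*} [Field C] {R F : Subfield C} {σ : C →+* C} {β η : C} {q : ℕ}
  {U : Set (Projectivization C (Fin 3 → C))}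

theorem eta_notMem (h : NormSubunital R σ β η q U) : η ∉ R := h.fst_notMem h.eta one_ne_zero

/-- The vertical group of a normalized subunital is a subfield. -/
theorem exists_subfield (h : NormSubunital R σ β η q U) :
    ∃ F : Subfield C, ∀ y, y ∈ F ↔ y ∈ h.vertical :=
  exists_subfield_of_harmonic h.vertical h.finite_vertical h.one fun a ha b hb ha0 hb0 hab ↦ by
    have := h.elation hb hb0 ha ha0 hab
    rwa [zero_mul, zero_div] at this

theorem subfield_le (h : NormSubunital R σ β η q U) (hF : ∀ y, y ∈ F ↔ y ∈ h.vertical) : F ≤ R :=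
  fun _ hy ↦ h.mem_of_mem_vertical ((hF _).1 hy)

theorem ncard_subfield (h : NormSubunital R σ β η q U) (hF : ∀ y, y ∈ F ↔ y ∈ h.vertical) :
    (F : Set C).ncard = q := by
  rw [← h.ncard_vertical]
  congr 1
  ext y
  exact hF y

theorem ncard_span (h : NormSubunital R σ β η q U) (hF : ∀ y, y ∈ F ↔ y ∈ h.vertical) :
    (pairSpan F η : Set C).ncard = q ^ 2 := by
  rw [ncard_pairSpan (h.subfield_le hF) h.eta_notMem, h.ncard_subfield hF]

theorem finite_span (h : NormSubunital R σ β η q U) (hF : ∀ y, y ∈ F ↔ y ∈ h.vertical) :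
    (pairSpan F η : Set C).Finite :=
  Set.finite_of_ncard_ne_zero (by rw [h.ncard_span hF]; have := h.two_le; positivity)

theorem exists_of_mem_span (h : NormSubunital R σ β η q U) (hF : ∀ y, y ∈ F ↔ y ∈ h.vertical)
    {x : C} (hx : x ∈ pairSpan F η) (hx0 : x ≠ 0) :
    ∃ p ∈ affinePart U, p.2 ≠ 0 ∧ p.1 / p.2 = x := by
  obtain ⟨b, hb, k, hk, rfl⟩ := hx
  have hη : ∀ f ∈ F, η + f ≠ 0 := fun f hf e ↦ h.eta_notMem <| by
    rw [eq_neg_of_add_eq_zero_left e]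
    exact R.neg_mem (h.subfield_le hF hf)
  have hη0 : η ≠ 0 := by simpa using hη 0 F.zero_mem
  by_cases hk0 : k = 0
  · subst hk0
    have hb0 : b ≠ 0 := by simpa using hx0
    have h1 := hη _ (F.neg_mem hb)
    have h2 := h.elation ((hF _).1 (F.neg_mem hb)) (neg_ne_zero.2 hb0) h.eta hη0 h1
    have h3 := h.add_mem ((hF _).1 hb) h2
    refine ⟨_, h3, div_ne_zero (by simpa using hb0) h1, ?_⟩
    field_simp
    ring
  · have ht : (b - k + 1) / k ∈ F := F.div_mem (F.add_mem (F.sub_mem hb hk) F.one_mem) hk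
    set t := (b - k + 1) / k with ht'
    have h1 := hη _ ht
    have h2 : η + t + 1 ≠ 0 := by rw [add_assoc]; exact hη _ (F.add_mem ht F.one_mem)
    have h3 := h.elation h.one one_ne_zero (h.add_mem ((hF _).1 ht) h.eta) h1 h2
    have h4 := h.add_mem ((hF _).1 (F.sub_mem hk F.one_mem)) h3
    refine ⟨_, h4, div_ne_zero (by simp) h2, ?_⟩
    have : b = t * k + k - 1 := by rw [ht']; field_simp; ring
    rw [this]
    field_simp
    ring

theorem slope_mem (h : NormSubunital R σ β η q U) (hF : ∀ y, y ∈ F ↔ y ∈ h.vertical) {y z : C}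
    (hy : (y, z) ∈ affinePart U) (hz : z ≠ 0) : y / z ∈ pairSpan F η := by
  have hsub : (pairSpan F η : Set C) \ {0} ⊆
      (fun p : C × C ↦ p.1 / p.2) '' {p ∈ affinePart U | p.2 ≠ 0} := by
    rintro x ⟨hx, hx0⟩
    obtain ⟨p, hp, hp2, e⟩ := h.exists_of_mem_span hF hx hx0
    exact ⟨p, ⟨hp, hp2⟩, e⟩
  have hfin : ((fun p : C × C ↦ p.1 / p.2) '' {p ∈ affinePart U | p.2 ≠ 0}).Finite :=
    (h.finite_affinePart.subset fun _ h ↦ h.1).image _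
  have hc := h.ncard_slopes
  have hd := Set.ncard_sdiff_singleton_add_one (s := (pairSpan F η : Set C))
    (pairSpan F η).zero_mem (h.finite_span hF)
  rw [h.ncard_span hF] at hd
  have e := Set.eq_of_subset_of_ncard_le hsub (by omega) hfin
  have : y / z ∈ (pairSpan F η : Set C) \ {0} := e ▸ ⟨(y, z), ⟨hy, hz⟩, rfl⟩
  exact this.1

/-- The last coordinates of the affine points are the inverses of the elements of the span. -/
theorem exists_mem_iff (h : NormSubunital R σ β η q U) (hF : ∀ y, y ∈ F ↔ y ∈ h.vertical) {z : C} :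
    (∃ y, (y, z) ∈ affinePart U) ↔ z⁻¹ ∈ pairSpan F η := by
  have hsub : Prod.snd '' affinePart U ⊆ (·⁻¹) '' (pairSpan F η : Set C) := by
    rintro _ ⟨⟨y, z⟩, hy, rfl⟩
    refine ⟨z⁻¹, ?_, inv_inv z⟩
    by_cases hz : z = 0
    · simp [hz]
    · have := (pairSpan F η).sub_mem (h.slope_mem hF (h.add_mem h.one hy) hz) (h.slope_mem hF hy hz)
      rwa [add_div, add_sub_cancel_left, one_div] at this
  have e := Set.eq_of_subset_of_ncard_le hsub
    (by rw [Set.ncard_image_of_injective _ inv_injective, h.ncard_span hF,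
      h.aff.card_snd h.two_le]) ((h.finite_span hF).image _)
  constructor
  · rintro ⟨y, hy⟩
    obtain ⟨x, hx, rfl⟩ := hsub ⟨(y, z), hy, rfl⟩
    simpa using hx
  · intro hz
    obtain ⟨⟨y, z'⟩, hy, rfl⟩ : z ∈ Prod.snd '' affinePart U := e ▸ ⟨_, hz, inv_inv z⟩
    exact ⟨y, hy⟩

end NormSubunital

section Normalize

variable {C : Type*} [Field C] {R F : Subfield C} {σ : C →+* C} {β η : C} {q : ℕ}
  {U : Set (Projectivization C (Fin 3 → C))}

theorem represents_inf_map_iff (L : (Fin 3 → C) ≃ₗ[C] (Fin 3 → C)) {c : C} (hc : c ≠ 0)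
    (hL : L.symm ![0, 1, 0] = c • ![0, 1, 0]) :
    Represents (Projectivization.map L.toLinearMap L.injective '' U) ![0, 1, 0] ↔
      Represents U ![0, 1, 0] := by
  rw [represents_map_iff, hL, represents_smul_iff hc]

theorem mem_affinePart_diag {g s : C} (hd : ∀ i, ![1, g⁻¹, s⁻¹] i ≠ 0) {y z : C} :
    (y, z) ∈ affinePart (Projectivization.map (diagEquiv _ hd).toLinearMap
      (LinearEquiv.injective _) '' U) ↔ (g * y, s * z) ∈ affinePart U := by
  change Represents _ _ ↔ Represents _ _
  rw [represents_map_iff]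
  congr! 1
  ext i
  rw [diagEquiv_symm_apply]
  fin_cases i <;> simp

theorem mem_affinePart_shear {a b c y z : C} :
    (y, z) ∈ affinePart (Projectivization.map (shearEquiv a b c).toLinearMap
      (LinearEquiv.injective _) '' U) ↔ (y + a - c * z, z + b) ∈ affinePart U := by
  change Represents _ _ ↔ Represents _ _
  rw [represents_map_iff, shearEquiv_symm_apply]
  simp

theorem ProjSubunital.pointed_shear (h : ProjSubunital R σ β q U) (hq : 2 ≤ q) (hσ : QuadConj R σ)
    (hβ : β ∉ R) (hinf : Represents U ![0, 1, 0]) {p : C × C} (hp : p ∈ affinePart U) :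
    PointedSubunital R σ β q (Projectivization.map
      (shearEquiv p.1 p.2 ((β - σ β) * σ p.2)).toLinearMap (LinearEquiv.injective _) '' U) where
  toProjSubunital := h.shear hσ hp
  two_le := hq
  conj := hσ
  notMem := hβ
  inf := by
    rw [represents_inf_map_iff _ one_ne_zero]
    · exact hinf
    · rw [shearEquiv_symm_apply]
      simp
  zero := by
    rw [mem_affinePart_shear]
    simpa using hp

namespace PointedSubunital

theorem exists_norm (h : PointedSubunital R σ β q U) :
    ∃ (g s : C) (hd : ∀ i, ![1, g⁻¹, s⁻¹] i ≠ 0) (β' η : C), NormSubunital R σ β' η q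
      (Projectivization.map (diagEquiv _ hd).toLinearMap (LinearEquiv.injective _) '' U) := by
  have hq := h.two_le
  obtain ⟨g, hg, hg0⟩ := Set.exists_ne_of_one_lt_ncard (h.ncard_vertical ▸ hq) 0
  have hS := h.aff.card_snd hq
  obtain ⟨_, ⟨⟨y, s⟩, hy, rfl⟩, hs0⟩ := Set.exists_ne_of_one_lt_ncard
    (s := Prod.snd '' affinePart U) (by rw [hS]; nlinarith) 0
  simp only at hs0
  have hd : ∀ i, ![1, g⁻¹, s⁻¹] i ≠ 0 := by
    intro i; fin_cases i <;> simp [hg0, hs0]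
  have hgR : g ∈ R := h.mem_of_mem_vertical hg
  refine ⟨g, s, hd, _, y / g, ⟨⟨h.toProjSubunital.diag hgR hd, hq, h.conj, fun hR ↦ h.notMem ?_,
    ?_, ?_⟩, ?_, ?_⟩⟩
  · have h2 : σ s * s ≠ 0 := mul_ne_zero ((map_ne_zero σ).2 hs0) hs0
    have := R.div_mem (R.mul_mem hR hgR) (h.conj.norm s)
    rwa [div_mul_cancel₀ _ hg0, mul_div_assoc, div_self h2, mul_one] at this
  · rw [represents_inf_map_iff _ hg0]
    · exact h.inf
    · ext i
      rw [diagEquiv_symm_apply]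
      fin_cases i <;> simp
  · rw [mem_affinePart_diag, mul_zero, mul_zero]
    exact h.zero
  · rw [mem_affinePart_diag, mul_one, mul_zero]
    exact hg
  · rw [mem_affinePart_diag, mul_div_cancel₀ _ hg0, mul_one]
    exact hy

theorem harmonic_snd (h : PointedSubunital R σ β q U) {z z' : C}
    (hz : ∃ y, (y, z) ∈ affinePart U) (hz' : ∃ y, (y, z') ∈ affinePart U) :
    ∃ y, (y, (z⁻¹ + z'⁻¹)⁻¹) ∈ affinePart U := by
  obtain ⟨g, s, hd, β', η, hN⟩ := h.exists_norm
  have hg0 : g ≠ 0 := by simpa using hd 1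
  have hs0 : s ≠ 0 := by simpa using hd 2
  obtain ⟨F, hF⟩ := hN.exists_subfield
  have key : ∀ w, (∃ y, (y, w) ∈ affinePart U) ↔ s * w⁻¹ ∈ pairSpan F η := by
    intro w
    have e : s * w⁻¹ = (w / s)⁻¹ := by simp [div_eq_mul_inv]
    rw [e, ← hN.exists_mem_iff hF]
    simp only [mem_affinePart_diag, mul_div_cancel₀ _ hs0]
    exact ⟨fun ⟨y, hy⟩ ↦ ⟨y / g, by rwa [mul_div_cancel₀ _ hg0]⟩, fun ⟨y, hy⟩ ↦ ⟨_, hy⟩⟩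
  rw [key] at hz hz' ⊢
  rw [inv_inv, mul_add]
  exact (pairSpan F η).add_mem hz hz'

end PointedSubunital

namespace NormSubunital

theorem one_mem_span (F : Subfield C) (η : C) : (1 : C) ∈ pairSpan F η :=
  ⟨1, F.one_mem, 0, F.zero_mem, by simp⟩

theorem exists_snd_add (h : NormSubunital R σ β η q U) {s s' : C}
    (hs : ∃ y, (y, s) ∈ affinePart U) (hs' : ∃ y, (y, s') ∈ affinePart U) :
    ∃ y, (y, s + s') ∈ affinePart U := by
  obtain ⟨F, hF⟩ := h.exists_subfield
  have hiff := fun z ↦ h.exists_mem_iff hF (z := z)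
  have h1 := one_mem_span F η
  -- the involution `s ↦ s / (s - 1)`
  have hinv : ∀ s, (∃ y, (y, s) ∈ affinePart U) → s ≠ 1 →
      ∃ y, (y, (s - 1)⁻¹ + 1) ∈ affinePart U := by
    intro s hs hs1
    rw [hiff] at hs ⊢
    by_cases hs0 : s = 0
    · simp [hs0]
    have hs1' : s - 1 ≠ 0 := sub_ne_zero.2 hs1
    have e : ((s - 1)⁻¹ + 1)⁻¹ = 1 - s⁻¹ := by
      have e' : (s - 1)⁻¹ + 1 = s / (s - 1) := by field_simp; ring
      rw [e', inv_div]
      field_simp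
    rw [e]
    exact (pairSpan F η).sub_mem h1 hs
  have hneg : ∀ s, (∃ y, (y, s) ∈ affinePart U) → ∃ y, (y, -s) ∈ affinePart U := by
    intro s hs
    rw [hiff] at hs ⊢
    rw [inv_neg]
    exact (pairSpan F η).neg_mem hs
  have hsub : ∀ s s', (∃ y, (y, s) ∈ affinePart U) → (∃ y, (y, s') ∈ affinePart U) →
      ∃ y, (y, s + s' - 1) ∈ affinePart U := by
    intro s s' hs hs'
    by_cases hs1 : s = 1
    · simpa [hs1] using hs'
    by_cases hs1' : s' = 1
    · simpa [hs1'] using hs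
    have hP := h.toProjSubunital.pointed_shear h.two_le h.conj h.notMem h.inf h.eta
    have hmem : ∀ z, (∃ y, (y, z) ∈ affinePart (Projectivization.map
        (shearEquiv η 1 ((β - σ β) * σ 1)).toLinearMap (LinearEquiv.injective _) '' U)) ↔
        ∃ y, (y, z + 1) ∈ affinePart U := by
      intro z
      simp only [mem_affinePart_shear]
      exact ⟨fun ⟨y, hy⟩ ↦ ⟨_, hy⟩, fun ⟨y, hy⟩ ↦ ⟨y - η + (β - σ β) * σ 1 * z, by
        convert hy using 2; ring⟩⟩
    have := hP.harmonic_snd ((hmem _).2 (hinv s hs hs1)) ((hmem _).2 (hinv s' hs' hs1'))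
    rw [hmem, inv_inv, inv_inv] at this
    by_cases h0 : s - 1 + (s' - 1) = 0
    · have e : s + s' - 1 = 1 := by linear_combination h0
      rw [e]
      exact ⟨η, h.eta⟩
    · have := hinv _ this (by simpa using h0)
      rw [add_sub_cancel_right, inv_inv] at this
      convert this using 4
      ring
  have hadd := hneg _ (hsub _ _ (hneg _ hs) (hneg _ hs'))
  have := hsub _ _ hadd ⟨0, h.zero⟩
  convert this using 4
  ring

theorem exists_subfield_span (h : NormSubunital R σ β η q U)
    (hF : ∀ y, y ∈ F ↔ y ∈ h.vertical) : ∃ E : Subfield C, ∀ x, x ∈ E ↔ x ∈ pairSpan F η := by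
  refine exists_subfield_of_harmonic _ (h.finite_span hF) (one_mem_span F η)
    fun a ha b hb ha0 hb0 hab ↦ ?_
  have hiff := fun z ↦ h.exists_mem_iff hF (z := z)
  have := h.exists_snd_add ((hiff a⁻¹).2 (by rwa [inv_inv])) ((hiff b⁻¹).2 (by rwa [inv_inv]))
  rw [hiff] at this
  rwa [inv_add_inv ha0 hb0, inv_div] at this

end NormSubunital

end Normalize

theorem Subfield.pow_card_eq {C : Type*} [Field C] (F : Subfield C) [Finite F] {x : C}
    (hx : x ∈ F) : x ^ Nat.card F = x := by
  have := Fintype.ofFinite F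
  rw [Nat.card_eq_fintype_card]
  exact congrArg Subtype.val (FiniteField.pow_card (⟨x, hx⟩ : F))

theorem Subfield.mem_of_pow_card_eq {C : Type*} [Field C] (F : Subfield C) [Finite F] {x : C}
    (hx : x ^ Nat.card F = x) : x ∈ F := by
  classical
  have := Fintype.ofFinite F
  by_contra hxF
  have h1 : 1 < Nat.card F := Finite.one_lt_card
  have hle := Polynomial.card_le_degree_of_subset_roots
    (p := (Polynomial.X ^ Nat.card F - Polynomial.X : Polynomial C))
    (Z := insert x (Finset.univ.image ((↑) : F → C))) fun y hy ↦ by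
      rw [Polynomial.mem_roots (FiniteField.X_pow_card_sub_X_ne_zero C h1)]
      have hy' : y ^ Nat.card F = y := by
        rcases Finset.mem_insert.1 hy with rfl | hy
        · exact hx
        · obtain ⟨z, -, rfl⟩ := Finset.mem_image.1 hy
          exact F.pow_card_eq z.2
      rw [Polynomial.IsRoot, Polynomial.eval_sub, Polynomial.eval_pow, Polynomial.eval_X, hy',
        sub_self]
  rw [FiniteField.X_pow_card_sub_X_natDegree_eq C h1, Finset.card_insert_of_notMem (by simpa),
    Finset.card_image_of_injective _ Subtype.val_injective, Finset.card_univ,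
    Nat.card_eq_fintype_card] at hle
  omega

namespace NormSubunital

variable {C : Type*} [Field C] {R F : Subfield C} {σ : C →+* C} {β η : C} {q : ℕ}
  {U : Set (Projectivization C (Fin 3 → C))}

/-- A normalized subunital is the affine Hermitian unital over a subfield `E` of order `q ^ 2`,
together with the point at infinity. -/
theorem exists_description (h : NormSubunital R σ β η q U) :
    ∃ E F : Subfield C, F ≤ E ∧ η ∈ E ∧ η ∉ F ∧ Nat.card E = q ^ 2 ∧ Nat.card F = q ∧
      (∀ x ∈ E, σ x = x ^ q) ∧ (∀ x ∈ E, x ^ q * x ∈ F) ∧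
      ∀ y z, (y, z) ∈ affinePart U ↔ z ∈ E ∧ y - z ^ q * z * η ∈ F := by
  obtain ⟨F, hF⟩ := h.exists_subfield
  obtain ⟨E, hE⟩ := h.exists_subfield_span hF
  have hq := h.two_le
  have hFR := h.subfield_le hF
  have hFE : F ≤ E := fun x hx ↦ (hE x).2 ⟨x, hx, 0, F.zero_mem, by simp⟩
  have hηE : η ∈ E := (hE η).2 ⟨0, F.zero_mem, 1, F.one_mem, by simp⟩
  have hηF : η ∉ F := fun h' ↦ h.eta_notMem (hFR h')
  have hcE : Nat.card E = q ^ 2 := by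
    rw [← h.ncard_span hF]
    exact congrArg Set.ncard (Set.ext hE)
  have hcF : Nat.card F = q := h.ncard_subfield hF
  have : Finite F := Nat.finite_of_card_ne_zero (by omega)
  have := Fintype.ofFinite F
  have hS : ∀ z, (∃ y, (y, z) ∈ affinePart U) ↔ z ∈ E := by
    intro z
    rw [h.exists_mem_iff hF, ← hE]
    exact ⟨fun h ↦ by simpa using E.inv_mem h, E.inv_mem⟩
  have hmem : ∀ y z, (y, z) ∈ affinePart U → σ z * z ∈ F ∧ y - σ z * z * η ∈ F := by
    intro y z hy
    have hyE : y ∈ E := by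
      by_cases hz : z = 0
      · subst hz
        exact hFE ((hF y).2 hy)
      · rw [← div_mul_cancel₀ y hz]
        exact E.mul_mem ((hE _).2 (h.slope_mem hF hy hz)) ((hS z).1 ⟨y, hy⟩)
    obtain ⟨a, ha, b, hb, rfl⟩ := (hE y).1 hyE
    have hN := h.conj.norm z
    have h1 := h.aff.herm _ h.eta
    rw [map_one, mul_one, mul_one] at h1
    have h2 := R.sub_mem (R.sub_mem (h.aff.herm _ hy) (R.mul_mem hN h1)) (hFR ha)
    have h3 : (b - σ z * z) * η ∈ R := by
      convert h2 using 1
      ring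
    have hbN : b = σ z * z := by
      by_contra hne
      have hne' := sub_ne_zero.2 hne
      have := R.div_mem h3 (R.sub_mem (hFR hb) hN)
      rw [mul_div_cancel_left₀ _ hne'] at this
      exact h.eta_notMem this
    rw [← hbN, add_sub_cancel_right]
    exact ⟨hb, ha⟩
  have hN : ∀ z ∈ E, σ z * z ∈ F := fun z hz ↦ by
    obtain ⟨y, hy⟩ := (hS z).2 hz
    exact (hmem y z hy).1
  have hP : ∀ y z, (y, z) ∈ affinePart U ↔ z ∈ E ∧ y - σ z * z * η ∈ F := by
    refine fun y z ↦ ⟨fun hy ↦ ⟨(hS z).1 ⟨y, hy⟩, (hmem y z hy).2⟩, fun ⟨hz, hy⟩ ↦ ?_⟩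
    obtain ⟨y₀, hy₀⟩ := (hS z).2 hz
    have := h.add_mem ((hF _).1 (F.sub_mem hy (hmem _ _ hy₀).2)) hy₀
    convert this using 2
    ring
  have hση : σ η = η ^ q := by
    have hT : σ η + η ∈ F := by
      have := F.sub_mem (F.sub_mem (hN (η + 1) (E.add_mem hηE E.one_mem)) (hN η hηE)) F.one_mem
      convert this using 1
      rw [map_add, map_one]
      ring
    have hφ : ∀ x ∈ F, x ^ q = x := fun x hx ↦ hcF ▸ F.pow_card_eq hx
    have hfrob : ∀ x, FiniteField.frobeniusAlgHom F C x = x ^ q := fun x ↦ by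
      rw [FiniteField.coe_frobeniusAlgHom, ← Nat.card_eq_fintype_card, hcF]
    have h1 : (η ^ q) ^ 2 - (σ η + η) * η ^ q + σ η * η = 0 := by
      have e := congrArg (FiniteField.frobeniusAlgHom F C)
        (show η ^ 2 - (σ η + η) * η + σ η * η = 0 by ring)
      rw [map_add, map_sub, map_mul (FiniteField.frobeniusAlgHom F C) (σ η + η), map_pow,
        map_zero] at e
      simp only [hfrob] at e
      rwa [hφ _ hT, hφ _ (hN η hηE)] at e
    have h2 : (η ^ q - η) * (η ^ q - σ η) = 0 := by linear_combination h1
    rcases mul_eq_zero.1 h2 with h3 | h3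
    · exact absurd (F.mem_of_pow_card_eq (by rw [hcF, sub_eq_zero.1 h3])) hηF
    · exact (sub_eq_zero.1 h3).symm
  have hσE : ∀ x ∈ E, σ x = x ^ q := by
    intro x hx
    obtain ⟨a, ha, b, hb, rfl⟩ := (hE x).1 hx
    have hfrob : ∀ x, x ^ q = FiniteField.frobeniusAlgHom F C x := fun x ↦ by
      rw [FiniteField.coe_frobeniusAlgHom, ← Nat.card_eq_fintype_card, hcF]
    have ha' := (FiniteField.frobeniusAlgHom F C).commutes ⟨a, ha⟩
    have hb' := (FiniteField.frobeniusAlgHom F C).commutes ⟨b, hb⟩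
    change FiniteField.frobeniusAlgHom F C a = a at ha'
    change FiniteField.frobeniusAlgHom F C b = b at hb'
    rw [hfrob, map_add (FiniteField.frobeniusAlgHom F C), map_mul (FiniteField.frobeniusAlgHom F C),
      ha', hb', ← hfrob, map_add, map_mul, h.conj.fix a (hFR ha), h.conj.fix b (hFR hb), hση]
  refine ⟨E, F, hFE, hηE, hηF, hcE, hcF, hσE, fun z hz ↦ ?_, fun y z ↦ ?_⟩
  · rw [← hσE z hz]
    exact hN z hz
  rw [hP]
  refine and_congr_right fun hz ↦ ?_
  rw [hσE z hz]

end NormSubunital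

section Reduction

variable {C : Type*} [Field C] {R : Subfield C} {σ : C →+* C} {β : C} {q : ℕ}
  {U : Set (Projectivization C (Fin 3 → C))}

theorem Projectivization.map_image_image (L L' : (Fin 3 → C) ≃ₗ[C] (Fin 3 → C)) :
    Projectivization.map L'.toLinearMap L'.injective ''
      (Projectivization.map L.toLinearMap L.injective '' U) =
      Projectivization.map (L.trans L').toLinearMap (L.trans L').injective '' U := by
  rw [Set.image_image]
  refine Set.image_congr fun P _ ↦ ?_
  induction P using Projectivization.ind with | h v hv => ?_
  simp only [Projectivization.map_mk]
  rfl

theorem ProjSubunital.exists_norm_of_inf (h : ProjSubunital R σ β q U) (hq : 2 ≤ q)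
    (hσ : QuadConj R σ) (hβ : β ∉ R) (hinf : Represents U ![0, 1, 0]) :
    ∃ (L : (Fin 3 → C) ≃ₗ[C] (Fin 3 → C)) (β' η : C), NormSubunital R σ β' η q
      (Projectivization.map L.toLinearMap L.injective '' U) := by
  obtain ⟨p, hp⟩ := Set.nonempty_of_ncard_ne_zero (s := affinePart U)
    (by rw [(h.affine hσ hβ hinf).card]; positivity)
  obtain ⟨g, s, hd, β', η, hN⟩ := (h.pointed_shear hq hσ hβ hinf hp).exists_norm
  rw [Projectivization.map_image_image] at hN
  exact ⟨_, β', η, hN⟩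

theorem ProjSubunital.exists_norm (h : ProjSubunital R σ β q U) (hq : 2 ≤ q) (hσ : QuadConj R σ)
    (hβ : β ∉ R) :
    ∃ (L : (Fin 3 → C) ≃ₗ[C] (Fin 3 → C)) (β' η : C), NormSubunital R σ β' η q
      (Projectivization.map L.toLinearMap L.injective '' U) := by
  by_cases hinf : Represents U ![0, 1, 0]
  · exact h.exists_norm_of_inf hq hσ hβ hinf
  obtain ⟨P, hP⟩ := Set.nonempty_of_ncard_ne_zero (s := U) (by rw [h.card]; omega)
  induction P using Projectivization.ind with | h v hv => ?_
  rcases h.cases hσ hβ ⟨hv, hP⟩ with ⟨c, hc, rfl⟩ | ⟨c, hc, p, hp, -⟩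
  · exact absurd ((represents_smul_iff hc).1 ⟨hv, hP⟩) hinf
  · obtain ⟨L, β', η, hN⟩ := ((h.shear hσ hp).swap hσ).exists_norm_of_inf hq hσ (hσ.notMem hβ) (by
      rw [represents_map_iff, swapEquiv_symm_apply, represents_map_iff, shearEquiv_symm_apply]
      simpa using show Represents U ![1, p.1, p.2] from hp)
    rw [Projectivization.map_image_image, Projectivization.map_image_image] at hN
    exact ⟨_, β', η, hN⟩

theorem quadConj_of_finrank_eq_two {ε t d : C} (hrank : Module.finrank R C = 2) (hε : ε ∉ R)
    (ht : t ∈ R) (hd : d ∈ R) (hmin : ε ^ 2 - t * ε + d = 0) (hσR : ∀ r ∈ R, σ r = r)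
    (hσε : σ ε = t - ε) : QuadConj R σ := by
  have hli : LinearIndependent R ![1, ε] := by
    rw [LinearIndependent.pair_iff]
    intro a b hab
    rw [Subfield.smul_def, Subfield.smul_def, smul_eq_mul, smul_eq_mul, mul_one] at hab
    have hb : b = 0 := by
      by_contra hb
      have hb' : (b : C) ≠ 0 := by simpa using hb
      apply hε
      have e : ε = -a / b := by
        rw [eq_div_iff hb']
        linear_combination hab
      rw [e]
      exact R.div_mem (R.neg_mem a.2) b.2
    subst hb
    simpa using hab
  have hspan := hli.span_eq_top_of_card_eq_finrank (by simp [hrank])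
  have hx : ∀ x, ∃ a ∈ R, ∃ b ∈ R, x = a + b * ε := by
    intro x
    have : x ∈ Submodule.span R (Set.range ![1, ε]) := hspan ▸ Submodule.mem_top
    rw [Matrix.range_cons_cons_empty, Submodule.mem_span_pair] at this
    obtain ⟨a, b, rfl⟩ := this
    exact ⟨a, a.2, b, b.2, by simp [Subfield.smul_def]⟩
  have hσx : ∀ a ∈ R, ∀ b ∈ R, σ (a + b * ε) = a + b * (t - ε) := fun a ha b hb ↦ by
    rw [map_add, map_mul, hσR a ha, hσR b hb, hσε]
  refine ⟨hσR, fun x ↦ ?_, fun x ↦ ?_, fun x ↦ ?_⟩ <;> obtain ⟨a, ha, b, hb, rfl⟩ := hx x <;>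
    rw [hσx a ha b hb]
  · rw [map_add, map_mul, map_sub, hσR a ha, hσR b hb, hσR t ht, hσε]
    ring
  · convert R.add_mem (R.add_mem ha ha) (R.mul_mem hb ht) using 1
    ring
  · convert R.add_mem (R.add_mem (R.mul_mem ha ha) (R.mul_mem (R.mul_mem ha hb) ht))
      (R.mul_mem (R.mul_mem hb hb) hd) using 1
    linear_combination -b ^ 2 * hmin

theorem mk_mem_hermSet_iff (hN : ∀ x, σ x * x ∈ R) {ε : C} {v : Fin 3 → C} (hv : v ≠ 0) :
    Projectivization.mk C v hv ∈ hermSet R σ ε ↔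
      ∃ r ∈ R, σ (v 0) * v 1 + σ (v 2) * v 2 = ε * r := by
  refine ⟨fun ⟨w, hw, e, r, hr, hrw⟩ ↦ ?_, fun h ↦ ⟨v, hv, rfl, h⟩⟩
  obtain ⟨c, rfl⟩ := (Projectivization.mk_eq_mk_iff' _ _ _ _ _).1 e
  refine ⟨σ c * c * r, R.mul_mem (hN c) hr, ?_⟩
  simp only [Pi.smul_apply, smul_eq_mul, map_mul]
  linear_combination σ c * c * hrw

theorem IsSubunital.lineUnital {ε : C} (h : IsSubunital R σ ε q U) : LineUnital q U where
  card := h.2.1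
  line f hf hn := by
    have e : {P ∈ U | f P.rep = 0} = hermSet R σ ε ∩ {P | f P.rep = 0} ∩ U := by
      ext P
      exact ⟨fun hP ↦ ⟨⟨h.1 hP.1, hP.2⟩, hP.1⟩, fun hP ↦ ⟨hP.2, hP.1.2⟩⟩
    rw [e] at hn ⊢
    exact h.2.2 _ ⟨_, ⟨f, hf, rfl⟩, hn.mono Set.inter_subset_left, rfl⟩ hn

theorem IsSubunital.exists_norm {ε : C} (h : IsSubunital R σ ε q U) (hq : 2 ≤ q)
    (hσ : QuadConj R σ) (hε : ε ∉ R) :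
    ∃ (L : (Fin 3 → C) ≃ₗ[C] (Fin 3 → C)) (β' η : C), NormSubunital R σ β' η q
      (Projectivization.map L.toLinearMap L.injective '' U) := by
  have hε0 : ε ≠ 0 := fun e ↦ hε (e ▸ R.zero_mem)
  have hd : ∀ i, ![1, ε⁻¹, 1] i ≠ 0 := by
    intro i; fin_cases i <;> simp [hε0]
  have hP : ProjSubunital R σ ε⁻¹ q (Projectivization.map (diagEquiv _ hd).toLinearMap
      (LinearEquiv.injective _) '' U) := by
    refine ⟨h.lineUnital.map _, fun v hv ↦ ?_⟩
    rw [represents_map_iff] at hv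
    obtain ⟨hw, hU⟩ := hv
    obtain ⟨r, hr, e⟩ := (mk_mem_hermSet_iff hσ.norm hw).1 (h.1 hU)
    simp only [diagEquiv_symm_apply, Matrix.cons_val, inv_one, one_mul, inv_inv] at e
    convert hr using 1
    field_simp
    linear_combination e
  obtain ⟨L, β', η, hN⟩ := hP.exists_norm hq hσ fun h ↦ hε (by simpa using R.inv_mem h)
  rw [Projectivization.map_image_image] at hN
  exact ⟨_, β', η, hN⟩

end Reduction

section Subplane

variable {C K : Type*} [Field C] [Field K]

/-- The semilinear map `K³ → C³` given by a field embedding, followed by a linear map. -/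
def subplaneMap (i : K →+* C) (M : (Fin 3 → C) ≃ₗ[C] (Fin 3 → C)) :
    (Fin 3 → K) →ₛₗ[i] (Fin 3 → C) where
  toFun v := M fun k ↦ i (v k)
  map_add' v w := by
    rw [← map_add]
    congr 1
    ext k
    simp
  map_smul' c v := by
    rw [← map_smul]
    congr 1
    ext k
    simp

variable {i : K →+* C} {M : (Fin 3 → C) ≃ₗ[C] (Fin 3 → C)}

theorem subplaneMap_apply (v : Fin 3 → K) : subplaneMap i M v = M fun k ↦ i (v k) := rfl

theorem subplaneMap_injective : Function.Injective (subplaneMap i M) := fun _ _ h ↦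
  funext fun k ↦ i.injective (congr_fun (M.injective h) k)

theorem map_subplaneMap_injective :
    Function.Injective (Projectivization.map (subplaneMap i M) subplaneMap_injective) := by
  intro P Q
  induction P using Projectivization.ind with | h v hv => ?_
  induction Q using Projectivization.ind with | h w hw => ?_
  simp only [Projectivization.map_mk, Projectivization.mk_eq_mk_iff']
  rintro ⟨c, hc⟩
  rw [subplaneMap_apply, subplaneMap_apply, ← map_smul, M.injective.eq_iff] at hc
  have hc' : ∀ k, c * i (w k) = i (v k) := congr_fun hc
  obtain ⟨k, hk⟩ := Function.ne_iff.1 hw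
  have hk' : i (w k) ≠ 0 := (map_ne_zero i).2 hk
  have e : c = i (v k / w k) := by rw [map_div₀, ← hc', mul_div_cancel_right₀ _ hk']
  refine ⟨v k / w k, funext fun l ↦ i.injective ?_⟩
  rw [← hc' l, e, Pi.smul_apply, smul_eq_mul, map_mul]

/-- A line of the plane over `C` that contains two points of a subplane is a line of the
subplane. -/
theorem exists_form_of_nontrivial {f : (Fin 3 → C) →ₗ[C] C} (hf : f ≠ 0)
    {S : Set (Projectivization K (Fin 3 → K))} (hS : S.Nontrivial)
    (hfS : ∀ P ∈ S, f (subplaneMap i M P.rep) = 0) :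
    ∃ f' : (Fin 3 → K) →ₗ[K] K, f' ≠ 0 ∧ ∀ v, f (subplaneMap i M v) = 0 ↔ f' v = 0 := by
  let W : Submodule K (Fin 3 → K) := LinearMap.ker (f.comp (subplaneMap i M))
  have hW : ∀ v, v ∈ W ↔ f (subplaneMap i M v) = 0 := fun v ↦ Iff.rfl
  have htop : W < ⊤ := by
    refine lt_top_iff_ne_top.2 fun e ↦ hf ?_
    have h0 : f ∘ₗ M.toLinearMap = 0 := by
      refine LinearMap.pi_ext' fun k ↦ LinearMap.ext_ring ?_
      have : Pi.single k (1 : K) ∈ W := e ▸ Submodule.mem_top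
      rw [hW, subplaneMap_apply] at this
      rw [LinearMap.zero_comp, LinearMap.zero_apply, ← this]
      change f (M _) = f (M _)
      congr 2
      ext l
      by_cases hl : l = k
      · subst hl; simp
      · simp [hl]
    ext v
    simpa using LinearMap.congr_fun h0 (M.symm (Pi.single v 1))
  obtain ⟨f', hf', hle⟩ := Submodule.exists_le_ker_of_lt_top W htop
  refine ⟨f', hf', fun v ↦ ?_⟩
  obtain ⟨P, hP, Q, hQ, hne⟩ := hS
  have hli : LinearIndependent K ![P.rep, Q.rep] := by
    have := (Projectivization.independent_pair_iff_ne P Q).2 hne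
    rw [Projectivization.independent_iff] at this
    have e : Projectivization.rep ∘ ![P, Q] = ![P.rep, Q.rep] := by
      ext k : 1
      fin_cases k <;> rfl
    exact e ▸ this
  have h2 : 2 ≤ Module.finrank K W := by
    have h3 : Module.finrank K (Submodule.span K (Set.range ![P.rep, Q.rep])) = 2 := by
      rw [finrank_span_eq_card hli, Fintype.card_fin]
    rw [← h3]
    refine Submodule.finrank_mono (Submodule.span_le.2 ?_)
    rintro _ ⟨k, rfl⟩
    fin_cases k
    · exact hfS P hP
    · exact hfS Q hQ
  have hker : Module.finrank K (LinearMap.ker f') ≤ 2 := by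
    have h3 := Submodule.finrank_lt (s := LinearMap.ker f')
      (lt_top_iff_ne_top.2 fun e ↦ hf' (LinearMap.ker_eq_top.1 e)).ne
    rw [Module.finrank_fin_fun] at h3
    omega
  have e := Submodule.eq_of_le_of_finrank_le hle (hker.trans h2)
  rw [← hW, e, LinearMap.mem_ker]

theorem exists_form_extension {f' : (Fin 3 → K) →ₗ[K] K} (hf' : f' ≠ 0) :
    ∃ f : (Fin 3 → C) →ₗ[C] C, f ≠ 0 ∧ ∀ v, f (subplaneMap i M v) = 0 ↔ f' v = 0 := by
  let g : (Fin 3 → C) →ₗ[C] C := ∑ k, i (f' (Pi.single k 1)) • LinearMap.proj k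
  have hg : ∀ v : Fin 3 → K, (g ∘ₗ M.symm.toLinearMap) (subplaneMap i M v) = i (f' v) := by
    intro v
    rw [subplaneMap_apply, LinearMap.comp_apply, LinearEquiv.coe_coe, M.symm_apply_apply,
      LinearMap.pi_apply_eq_sum_univ f' v]
    have hs : ∀ k : Fin 3, (fun j ↦ if k = j then (1 : K) else 0) = Pi.single k 1 := fun k ↦ by
      ext j
      simp [Pi.single_apply, eq_comm]
    simp [g, hs, mul_comm]
  refine ⟨g ∘ₗ M.symm.toLinearMap, fun e ↦ hf' ?_, fun v ↦ by rw [hg, map_eq_zero]⟩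
  refine LinearMap.ext fun v ↦ ?_
  have := hg v
  rw [e, LinearMap.zero_apply, eq_comm, map_eq_zero] at this
  exact this

/-- A set `U` of points that is the image of a set `H` of points of a subplane carries the same
incidence structure as `H`. -/
theorem exists_bijOn_subplane {U : Set (Projectivization C (Fin 3 → C))}
    {H : Set (Projectivization K (Fin 3 → K))}
    (hH : ∀ v (hv : v ≠ 0), Projectivization.mk K v hv ∈ H ↔ Represents U (subplaneMap i M v))
    (hU : ∀ w, Represents U w → ∃ (c : C) (v : Fin 3 → K), c ≠ 0 ∧ w = c • subplaneMap i M v) :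
    ∃ φ : Projectivization C (Fin 3 → C) → Projectivization K (Fin 3 → K), Set.BijOn φ U H ∧
      (∀ f : (Fin 3 → C) →ₗ[C] C, f ≠ 0 → {P ∈ U | f P.rep = 0}.Nontrivial →
        ∃ f' : (Fin 3 → K) →ₗ[K] K, f' ≠ 0 ∧
          φ '' {P ∈ U | f P.rep = 0} = {P ∈ H | f' P.rep = 0}) ∧
      ∀ f' : (Fin 3 → K) →ₗ[K] K, f' ≠ 0 → ∃ f : (Fin 3 → C) →ₗ[C] C, f ≠ 0 ∧
          φ '' {P ∈ U | f P.rep = 0} = {P ∈ H | f' P.rep = 0} := by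
  let ψ := Projectivization.map (subplaneMap i M) subplaneMap_injective
  have hne : ∀ {v : Fin 3 → K}, v ≠ 0 → subplaneMap i M v ≠ 0 := fun hv h ↦
    hv (subplaneMap_injective (h.trans (map_zero _).symm))
  have hψ : ∀ v (hv : v ≠ 0), ψ (Projectivization.mk K v hv) =
      Projectivization.mk C (subplaneMap i M v) (hne hv) := fun v hv ↦ rfl
  have hbij : Set.BijOn ψ H U := by
    refine ⟨fun P hP ↦ ?_, map_subplaneMap_injective.injOn, fun P hP ↦ ?_⟩
    · induction P using Projectivization.ind with | h v hv => ?_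
      exact ((hH v hv).1 hP).2
    · induction P using Projectivization.ind with | h w hw => ?_
      obtain ⟨c, v, hc, e⟩ := hU w ⟨hw, hP⟩
      have hv : v ≠ 0 := by
        rintro rfl
        exact hw (by rw [e, map_zero, smul_zero])
      refine ⟨Projectivization.mk K v hv, (hH v hv).2 ?_, ?_⟩
      · rw [← represents_smul_iff hc, ← e]
        exact ⟨hw, hP⟩
      · rw [hψ]
        exact Eq.symm ((Projectivization.mk_eq_mk_iff' _ _ _ _ _).2 ⟨c, e.symm⟩)
  have hrep : ∀ (f : (Fin 3 → C) →ₗ[C] C) (P : Projectivization K (Fin 3 → K)),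
      f (ψ P).rep = 0 ↔ f (subplaneMap i M P.rep) = 0 := by
    intro f P
    conv_lhs => rw [← P.mk_rep, hψ, Projectivization.apply_rep_eq_zero_iff]
  have hinv := hbij.invOn_invFunOn
  have himg : ∀ (f : (Fin 3 → C) →ₗ[C] C), Function.invFunOn ψ H '' {P ∈ U | f P.rep = 0} =
      {P ∈ H | f (subplaneMap i M P.rep) = 0} := by
    intro f
    ext Q
    constructor
    · rintro ⟨P, ⟨hP, hfP⟩, rfl⟩
      obtain ⟨Q, hQ, rfl⟩ := hbij.surjOn hP
      rw [hinv.1 hQ]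
      exact ⟨hQ, (hrep f Q).1 hfP⟩
    · rintro ⟨hQ, hfQ⟩
      exact ⟨ψ Q, ⟨hbij.mapsTo hQ, (hrep f Q).2 hfQ⟩, hinv.1 hQ⟩
  have hbij' : Set.BijOn (Function.invFunOn ψ H) U H := hbij.symm hinv.symm
  refine ⟨Function.invFunOn ψ H, hbij', fun f hf hn ↦ ?_, fun f' hf' ↦ ?_⟩
  · have hn' := hn.image_of_injOn (hbij'.injOn.mono fun _ h ↦ h.1)
    rw [himg] at hn'
    obtain ⟨f', hf', h⟩ := exists_form_of_nontrivial hf hn' fun P hP ↦ hP.2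
    refine ⟨f', hf', (himg f).trans ?_⟩
    simp only [h]
  · obtain ⟨f, hf, h⟩ := exists_form_extension (i := i) (M := M) hf'
    refine ⟨f, hf, (himg f).trans ?_⟩
    simp only [h]

end Subplane

section Coordinates

variable {C K : Type*} [Field C] [Field K] {R : Subfield C} {σ : C →+* C} {β η : C} {q : ℕ}
  {V : Set (Projectivization C (Fin 3 → C))} {E F : Subfield C} {i : K →+* C} {e : K}

theorem norm_mem_comap (hi : ∀ x, i x ∈ E) (hN : ∀ x ∈ E, x ^ q * x ∈ F) (x : K) :
    x ^ q * x ∈ F.comap i := by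
  rw [Subfield.mem_comap, map_mul, map_pow]
  exact hN _ (hi x)

theorem NormSubunital.represents_iff (h : NormSubunital R σ β η q V) (hi : ∀ x, i x ∈ E)
    (hN : ∀ x ∈ E, x ^ q * x ∈ F)
    (hV : ∀ y z, (y, z) ∈ affinePart V ↔ z ∈ E ∧ y - z ^ q * z * η ∈ F)
    (he : i e = η) (hηF : η ∉ F) {v : Fin 3 → K} (hv : v ≠ 0) :
    Represents V ![i (v 0), -η * i (v 1), i (v 2)] ↔
      ∃ r ∈ F.comap i, v 0 ^ q * v 1 + v 2 ^ q * v 2 = e⁻¹ * r := by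
  have hη0 : η ≠ 0 := fun h ↦ hηF (h ▸ F.zero_mem)
  have he0 : e ≠ 0 := fun h ↦ hη0 (by rw [← he, h, map_zero])
  have hNF := norm_mem_comap hi hN
  have hq : q ≠ 0 := by have := h.two_le; omega
  have hN0 : ∀ {x : K}, x ≠ 0 → x ^ q * x ≠ 0 := fun hx ↦ mul_ne_zero (pow_ne_zero _ hx) hx
  by_cases h0 : v 0 = 0
  · have hiff : Represents V ![i (v 0), -η * i (v 1), i (v 2)] ↔ v 2 = 0 := by
      constructor
      · intro hr
        simpa using h.snd_eq_zero h.conj h.notMem hr (by simp [h0])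
      · intro h2
        have h1 : v 1 ≠ 0 := fun h1 ↦ hv (by ext k; fin_cases k <;> simp [h0, h1, h2])
        have hc : -η * i (v 1) ≠ 0 := mul_ne_zero (neg_ne_zero.2 hη0) ((map_ne_zero i).2 h1)
        have hs : ![i (v 0), -η * i (v 1), i (v 2)] = (-η * i (v 1)) • ![0, 1, 0] := by
          ext k; fin_cases k <;> simp [h0, h2]
        rw [hs, represents_smul_iff hc]
        exact h.inf
    rw [hiff, h0, zero_pow hq, zero_mul, zero_add]
    constructor
    · intro h2
      exact ⟨0, Subfield.zero_mem _, by simp [h2]⟩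
    · rintro ⟨r, hr, e'⟩
      by_contra h2
      have hr' : e = r / (v 2 ^ q * v 2) := by
        rw [eq_div_iff (hN0 h2), e', mul_inv_cancel_left₀ he0]
      have : e ∈ F.comap i := hr' ▸ Subfield.div_mem _ hr (hNF _)
      rw [Subfield.mem_comap, he] at this
      exact hηF this
  · have h0' : i (v 0) ≠ 0 := (map_ne_zero i).2 h0
    have hs : ![i (v 0), -η * i (v 1), i (v 2)] =
        i (v 0) • ![1, -η * i (v 1 / v 0), i (v 2 / v 0)] := by
      ext k; fin_cases k <;> simp <;> field_simp
    rw [hs, represents_smul_iff h0']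
    change (-η * i (v 1 / v 0), i (v 2 / v 0)) ∈ affinePart V ↔ _
    rw [hV, and_iff_right (hi _)]
    have hc : -η * i (v 1 / v 0) - i (v 2 / v 0) ^ q * i (v 2 / v 0) * η =
        i (-(e * (v 0 ^ q * v 1 + v 2 ^ q * v 2) / (v 0 ^ q * v 0))) := by
      simp only [← he, ← map_pow, ← map_mul, ← map_neg, ← map_sub]
      congr 1
      rw [div_pow]
      field_simp
      ring
    rw [hc, ← Subfield.mem_comap]
    constructor
    · intro hm
      refine ⟨_, Subfield.mul_mem _ (Subfield.neg_mem _ hm) (hNF (v 0)), ?_⟩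
      have := hN0 h0
      field_simp
    · rintro ⟨r, hr, e'⟩
      rw [e', mul_inv_cancel_left₀ he0]
      exact Subfield.neg_mem _ (Subfield.div_mem _ hr (hNF _))

theorem NormSubunital.exists_coordinates (h : NormSubunital R σ β η q V)
    (hi : ∀ x, x ∈ E ↔ ∃ k, i k = x) (hFE : F ≤ E)
    (hV : ∀ y z, (y, z) ∈ affinePart V ↔ z ∈ E ∧ y - z ^ q * z * η ∈ F)
    (he : i e = η) (hη0 : η ≠ 0) {w : Fin 3 → C} (hw : Represents V w) :
    ∃ (c : C) (v : Fin 3 → K), c ≠ 0 ∧ w = c • ![i (v 0), -η * i (v 1), i (v 2)] := by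
  have he0 : e ≠ 0 := fun h ↦ hη0 (by rw [← he, h, map_zero])
  rcases h.cases h.conj h.notMem hw with ⟨c, hc, rfl⟩ | ⟨c, hc, ⟨y, z⟩, hp, rfl⟩
  · refine ⟨-c / η, ![0, 1, 0], div_ne_zero (neg_ne_zero.2 hc) hη0, ?_⟩
    ext k; fin_cases k <;> simp [hη0]
  · obtain ⟨hz, hy⟩ := (hV y z).1 hp
    have hηE : η ∈ E := (hi η).2 ⟨e, he⟩
    have hyE : y ∈ E := by
      simpa using E.add_mem (hFE hy) (E.mul_mem (E.mul_mem (E.pow_mem hz q) hz) hηE)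
    obtain ⟨z', rfl⟩ := (hi z).1 hz
    obtain ⟨y', rfl⟩ := (hi y).1 hyE
    refine ⟨c, ![1, -(y' / e), z'], hc, ?_⟩
    congr 1
    ext k; fin_cases k <;> simp [he]
    field_simp

end Coordinates

/-- A finite subfield is isomorphic to a field in the lowest universe. -/
theorem Subfield.exists_small_model {C : Type*} [Field C] (E : Subfield C) [Finite E] :
    ∃ (K : Type) (_ : Field K) (i : K →+* C), ∀ x, x ∈ E ↔ ∃ k, i k = x := by
  let f := (Finite.equivFin E).symm
  let := f.field
  refine ⟨Fin (Nat.card E), f.field, E.subtype.comp f.ringEquiv.toRingHom,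
    fun x ↦ ⟨fun hx ↦ ⟨f.symm ⟨x, hx⟩, ?_⟩, ?_⟩⟩
  · exact congrArg Subtype.val (f.apply_symm_apply ⟨x, hx⟩)
  · rintro ⟨k, rfl⟩
    exact (f k).2

theorem Subfield.card_comap {C K : Type*} [Field C] [Field K] {E F : Subfield C} {i : K →+* C}
    (hi : ∀ x, x ∈ E ↔ ∃ k, i k = x) (hFE : F ≤ E) : Nat.card (F.comap i) = Nat.card F := by
  have e : i '' (F.comap i : Set K) = F := by
    ext x
    constructor
    · rintro ⟨k, hk, rfl⟩
      exact hk
    · intro hx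
      obtain ⟨k, rfl⟩ := (hi x).1 (hFE hx)
      exact ⟨k, hx, rfl⟩
  change (F.comap i : Set K).ncard = (F : Set C).ncard
  rw [← e, Set.ncard_image_of_injective _ i.injective]

/-- Every finite subunital of order `q` of a generalized hermitian unital is isomorphic
(as an incidence structure) to the hermitian unital `H(GF(q²)|GF(q))`. -/
theorem subunital_iso_hermitian_unital
    {C : Type*} [Field C] (R : Subfield C) (ε t d : C) (σ : C →+* C)
    (hrank : Module.finrank R C = 2)
    (hε : ε ∉ R) (ht : t ∈ R) (hd : d ∈ R)
    (hmin : ε ^ 2 - t * ε + d = 0)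
    (hσR : ∀ r ∈ R, σ r = r) (hσε : σ ε = t - ε)
    (q : ℕ) (hq : 2 ≤ q)
    (U : Set (Projectivization C (Fin 3 → C))) (hU : IsSubunital R σ ε q U) :
    IsPrimePow q ∧
    ∃ (E : Type) (_ : Field E) (F : Subfield E) (ε' : E) (σE : E →+* E),
      Nat.card E = q ^ 2 ∧ Nat.card F = q ∧ ε' ∉ F ∧ (∀ x : E, σE x = x ^ q) ∧
      ∃ φ : Projectivization C (Fin 3 → C) → Projectivization E (Fin 3 → E),
        Set.BijOn φ U (hermSet F σE ε') ∧
        (∀ B, IsHermBlock R σ ε B → (B ∩ U).Nontrivial →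
          IsHermBlock F σE ε' (φ '' (B ∩ U))) ∧
        (∀ B', IsHermBlock F σE ε' B' →
          ∃ B, IsHermBlock R σ ε B ∧ (B ∩ U).Nontrivial ∧ φ '' (B ∩ U) = B') := by
  have hσ := quadConj_of_finrank_eq_two hrank hε ht hd hmin hσR hσε
  obtain ⟨L, β, η, h⟩ := hU.exists_norm hq hσ hε
  obtain ⟨E, F, hFE, hηE, hηF, hcE, hcF, hσE, hN, hV⟩ := h.exists_description
  have : Finite E := Nat.finite_of_card_ne_zero (by rw [hcE]; positivity)
  have : Finite F := Nat.finite_of_card_ne_zero (by rw [hcF]; positivity)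
  obtain ⟨K, _, i, hi⟩ := E.exists_small_model
  have hi' : ∀ x, i x ∈ E := fun x ↦ (hi _).2 ⟨x, rfl⟩
  obtain ⟨e, he⟩ := (hi η).1 hηE
  have hη0 : η ≠ 0 := fun h ↦ hηF (h ▸ F.zero_mem)
  let τ : K →+* K :=
    { powMonoidHom q with
      map_zero' := zero_pow (by omega)
      map_add' x y := i.injective (by
        change i ((x + y) ^ q) = i (x ^ q + y ^ q)
        rw [map_add, map_pow, map_pow, map_pow, ← hσE _ (hi' _), ← hσE _ (hi' x),
          ← hσE _ (hi' y), map_add, map_add]) }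
  have hτ : ∀ x, τ x = x ^ q := fun x ↦ rfl
  have hNF := norm_mem_comap hi' hN
  have hd : ∀ k, ![1, -η, 1] k ≠ 0 := by
    intro k; fin_cases k <;> simp [hη0]
  let M := (diagEquiv _ hd).trans L.symm
  have hdiag : ∀ v : Fin 3 → K, diagEquiv _ hd (fun k ↦ i (v k)) =
      ![i (v 0), -η * i (v 1), i (v 2)] := by
    intro v
    ext k
    rw [diagEquiv_apply]
    fin_cases k <;> simp
  have hM : ∀ v : Fin 3 → K, subplaneMap i M v = L.symm ![i (v 0), -η * i (v 1), i (v 2)] :=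
    fun v ↦ congrArg L.symm (hdiag v)
  refine ⟨?_, K, inferInstance, F.comap i, e⁻¹, τ, ?_, ?_, fun hm ↦ hηF ?_, hτ, ?_⟩
  · have := Fintype.ofFinite F
    rw [← hcF, Nat.card_eq_fintype_card]
    exact FiniteField.isPrimePow_card F
  · rw [← hcE, ← Subfield.card_comap hi le_rfl]
    exact Nat.card_congr (Equiv.subtypeUnivEquiv hi').symm
  · rw [← hcF, Subfield.card_comap hi hFE]
  · rw [← he]
    simpa using Subfield.inv_mem _ hm
  obtain ⟨φ, hφ, hφ₁, hφ₂⟩ := exists_bijOn_subplane (i := i) (M := M) (U := U)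
    (H := hermSet (F.comap i) τ e⁻¹)
    (fun v hv ↦ by
      rw [hM, ← represents_map_iff, h.represents_iff hi' hN hV he hηF hv,
        mk_mem_hermSet_iff (by simpa only [hτ] using hNF)]
      simp only [hτ])
    (fun w hw ↦ by
      rw [← L.symm_apply_apply w, ← represents_map_iff] at hw
      obtain ⟨c, v, hc, e'⟩ := h.exists_coordinates hi hFE hV he hη0 hw
      refine ⟨c, v, hc, ?_⟩
      rw [hM, ← map_smul, ← e', L.symm_apply_apply])
  have hBU : ∀ f : (Fin 3 → C) →ₗ[C] C,
      hermSet R σ ε ∩ {P | f P.rep = 0} ∩ U = {P ∈ U | f P.rep = 0} := by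
    intro f
    ext P
    exact ⟨fun hP ↦ ⟨hP.2, hP.1.2⟩, fun hP ↦ ⟨⟨hU.1 hP.1, hP.2⟩, hP.1⟩⟩
  refine ⟨φ, hφ, ?_, ?_⟩
  · rintro B ⟨_, ⟨f, hf, rfl⟩, -, rfl⟩ hn
    rw [hBU] at hn ⊢
    obtain ⟨f', hf', e'⟩ := hφ₁ f hf hn
    rw [e']
    refine ⟨_, ⟨f', hf', rfl⟩, ?_, rfl⟩
    have := hn.image_of_injOn (hφ.injOn.mono fun _ h ↦ h.1)
    rwa [e'] at this
  · rintro B' ⟨_, ⟨f', hf', rfl⟩, hn, rfl⟩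
    obtain ⟨f, hf, e'⟩ := hφ₂ f' hf'
    have hn' : {P ∈ U | f P.rep = 0}.Nontrivial := Set.nontrivial_of_image φ _ (e' ▸ hn)
    rw [← hBU] at hn' e'
    exact ⟨_, ⟨_, ⟨f, hf, rfl⟩, hn'.mono Set.inter_subset_left, rfl⟩, hn', e'⟩
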